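/- arXiv:1711.09359 — 2 statements merged into one kernel-verified Lean document; each statement's English description precedes it below -/
import Mathlib

section
/- Suppose there exist T₀ > 0 and C > 0 such that the semiclassical observability inequality ‖u₀‖²_{L²(𝕋)} ≤ C ∫₀^{T₀} ‖g · Sʰ(t)u₀‖²_{L²(𝕋)} dt + C ‖u₀‖²_{H^{−1}(𝕋)} holds for all u₀ ∈ L²₀(𝕋), uniformly for all h ∈ (0,1). Then for every T > 0 there exists C' > 0 such that the weak observability inequality ‖u₀‖²_{L²(𝕋)} ≤ C' ∫₀ᵀ ‖g · S_λ(t)u₀‖²_{L²(𝕋)} dt + C' ‖u₀‖²_{H^{−1}(𝕋)} holds for all λ ≥ 0 and all u₀ ∈ L²₀(𝕋). -/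
open MeasureTheory Real Filter

noncomputable section

instance : Fact (0 < 2 * Real.pi) := ⟨by positivity⟩

/-- The torus `𝕋 = ℝ/2πℤ`. -/
abbrev Torus := AddCircle (2 * Real.pi)

/-- `L²(𝕋)`. -/
abbrev L2T := Lp ℂ 2 (volume : Measure Torus)

/-- Fourier coefficient `û(k) = (1/2π) ∫_𝕋 u(x) e^{-ikx} dx`. -/
def fc (u : Torus → ℂ) (k : ℤ) : ℂ :=
  (1 / (2 * Real.pi)) * ∫ x : Torus, fourier (-k) x * u x

/-- Membership in `L²₀(𝕋)`: the mean `û(0)` vanishes. -/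
def MeanZero (u : L2T) : Prop := fc (u : Torus → ℂ) 0 = 0

/-- The squared `H⁻¹(𝕋)` norm `‖u‖²_{H⁻¹} = Σ_k (1+k²)⁻¹ |û(k)|²`. -/
def Hneg1Sq (u : L2T) : ℝ := ∑' k : ℤ, (1 + (k : ℝ) ^ 2)⁻¹ * ‖fc (u : Torus → ℂ) k‖ ^ 2

/-- Squared `L²` norm of the pointwise product `g · v`. -/
def gMulNormSq (g : Torus → ℝ) (v : L2T) : ℝ :=
  ∫ x : Torus, ‖(g x : ℂ) * (v : Torus → ℂ) x‖ ^ 2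

/-- Spectral characterization of the unitary group `S_λ(t)` on `L²₀(𝕋)` solving
`∂ₜu + ∂ₓ³u - λ²∂ₓ⁻¹u = 0`: `(S_λ(t)u)^(k) = e^{it(k³ - λ²/k)} û(k)` for `k ≠ 0`. -/
def IsLamGroup (lam : ℝ) (S : ℝ → L2T →L[ℂ] L2T) : Prop :=
  ∀ t : ℝ, ∀ u : L2T, MeanZero u →
    MeanZero (S t u) ∧
      ∀ k : ℤ, k ≠ 0 →
        fc (S t u : Torus → ℂ) k =
          Complex.exp (Complex.I * (t : ℂ) * ((k : ℂ) ^ 3 - (lam : ℂ) ^ 2 / (k : ℂ))) *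
            fc (u : Torus → ℂ) k

/-- Spectral characterization of the semiclassical unitary group `Sʰ(t)` on `L²₀(𝕋)` solving
`h∂ₜu + (h∂ₓ)³u - (h∂ₓ)⁻¹u = 0`: `(Sʰ(t)u)^(k) = e^{it(h²k³ - 1/(h²k))} û(k)` for `k ≠ 0`. -/
def IsSemiGroup (h : ℝ) (S : ℝ → L2T →L[ℂ] L2T) : Prop :=
  ∀ t : ℝ, ∀ u : L2T, MeanZero u →
    MeanZero (S t u) ∧
      ∀ k : ℤ, k ≠ 0 →
        fc (S t u : Torus → ℂ) k =
          Complex.exp (Complex.I * (t : ℂ) *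
              ((h : ℂ) ^ 2 * (k : ℂ) ^ 3 - 1 / ((h : ℂ) ^ 2 * (k : ℂ)))) *
            fc (u : Torus → ℂ) k

/-- `(𝒢 v)(x) = g(x) (v(x) - ∫_𝕋 g(x') v(x') dx')` (a.e.). -/
def IsG (g : Torus → ℝ) (G : L2T →L[ℂ] L2T) : Prop :=
  ∀ v : L2T, ∀ᵐ x ∂(volume : Measure Torus),
    (G v : Torus → ℂ) x =
      (g x : ℂ) * ((v : Torus → ℂ) x - ∫ x' : Torus, (g x' : ℂ) * (v : Torus → ℂ) x')

/-- The Fourier multiplier `m(hDₓ)`: `(m(hDₓ)u)^(k) = m(hk) û(k)`. -/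
def IsMult (m : ℝ → ℝ) (h : ℝ) (M : L2T →L[ℂ] L2T) : Prop :=
  ∀ u : L2T, ∀ k : ℤ, fc (M u : Torus → ℂ) k = (m (h * k) : ℂ) * fc (u : Torus → ℂ) k

theorem half_mul_abs_le_abs_phase_sub {k l : ℤ} (hkl : k ≠ l) (hk : k ≠ 0) (hl : l ≠ 0) {lam : ℝ}
    (hlam : 2 * lam ^ 2 ≤ (k : ℝ) ^ 2) :
    |(k : ℝ)| * |(l : ℝ)| / 2 ≤
      |((k : ℝ) ^ 3 - lam ^ 2 / k) - ((l : ℝ) ^ 3 - lam ^ 2 / l)| := by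
  have hk' : (k : ℝ) ≠ 0 := by exact_mod_cast hk
  have hl' : (l : ℝ) ≠ 0 := by exact_mod_cast hl
  have h1 : (1 : ℝ) ≤ |(k : ℝ) - l| := by
    have := Int.one_le_abs (sub_ne_zero.mpr hkl)
    exact_mod_cast this
  have hl1 : (1 : ℝ) ≤ |(l : ℝ)| := by exact_mod_cast Int.one_le_abs hl
  have hk1 : (1 : ℝ) ≤ |(k : ℝ)| := by exact_mod_cast Int.one_le_abs hk
  have hfac : ((k : ℝ) ^ 3 - lam ^ 2 / k) - ((l : ℝ) ^ 3 - lam ^ 2 / l) =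
      (k - l) * ((k : ℝ) ^ 2 + k * l + l ^ 2 + lam ^ 2 / (k * l)) := by
    field_simp
    ring
  have hq : -(|(k : ℝ)| * |(l : ℝ)| / 2) ≤ lam ^ 2 / (k * l) := by
    apply neg_le_of_abs_le
    rw [abs_div, abs_mul, abs_of_nonneg (sq_nonneg lam), div_le_div_iff₀ (by positivity) two_pos]
    rw [← sq_abs (k : ℝ)] at hlam
    nlinarith [mul_nonneg (sq_nonneg |(k : ℝ)|) (by nlinarith : (0 : ℝ) ≤ |(l : ℝ)| ^ 2 - 1)]
  have hp : |(k : ℝ)| * |(l : ℝ)| ≤ (k : ℝ) ^ 2 + k * l + l ^ 2 := by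
    have := neg_abs_le ((k : ℝ) * l)
    rw [abs_mul] at this
    nlinarith [sq_nonneg (|(k : ℝ)| - |(l : ℝ)|), sq_abs (k : ℝ), sq_abs (l : ℝ)]
  have hpos : |(k : ℝ)| * |(l : ℝ)| / 2 ≤ (k : ℝ) ^ 2 + k * l + l ^ 2 + lam ^ 2 / (k * l) := by
    linarith
  rw [hfac, abs_mul]
  calc _ ≤ _ := hpos
    _ ≤ _ := le_abs_self _
    _ ≤ _ := le_mul_of_one_le_left (abs_nonneg _) h1

theorem norm_intervalIntegral_exp_le (T : ℝ) {w : ℝ} (hw : w ≠ 0) :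
    ‖∫ t in (0 : ℝ)..T, Complex.exp (Complex.I * t * w)‖ ≤ 2 / |w| := by
  have hc : Complex.I * (w : ℂ) ≠ 0 := by simp [hw]
  have h := integral_exp_mul_complex (a := 0) (b := T) hc
  have h2 : (fun t : ℝ ↦ Complex.exp (Complex.I * t * w)) =
      fun t : ℝ ↦ Complex.exp (Complex.I * w * t) := by
    ext t; ring_nf
  rw [h2, h, norm_div]
  have h3 : ‖Complex.I * (w : ℂ)‖ = |w| := by simp
  rw [h3]
  gcongr
  refine (norm_sub_le _ _).trans ?_
  have h4 (t : ℝ) : ‖Complex.exp (Complex.I * w * t)‖ = 1 := by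
    rw [show Complex.I * (w : ℂ) * t = ((w * t : ℝ) : ℂ) * Complex.I by push_cast; ring,
      Complex.norm_exp_ofReal_mul_I]
  rw [h4, h4]
  norm_num

theorem integral_norm_sq_exp_sum_lower_bound {E : Type*} [NormedAddCommGroup E]
    [InnerProductSpace ℂ E] (F : Finset ℤ) (c : ℤ → ℂ) (v : ℤ → E) (w : ℤ → ℝ) {γ η T : ℝ}
    (hv : ∀ k, ‖v k‖ ^ 2 = γ) (hF : (0 : ℤ) ∉ F)
    (hw : ∀ k ∈ F, ∀ l ∈ F, k ≠ l → |(k : ℝ)| * |(l : ℝ)| / 2 ≤ |w k - w l|)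
    (hη : ∑ k ∈ F, 1 / (k : ℝ) ^ 2 ≤ η) :
    γ * (T - 4 * η) * ∑ k ∈ F, ‖c k‖ ^ 2 ≤
      ∫ t in (0 : ℝ)..T, ‖∑ k ∈ F, (Complex.exp (Complex.I * t * w k) * c k) • v k‖ ^ 2 := by
  have hγ : 0 ≤ γ := hv 0 ▸ sq_nonneg _
  set a : ℤ → ℤ → ℂ := fun k l ↦ (starRingEnd ℂ (c k)) * c l * inner ℂ (v k) (v l) with ha
  set J : ℤ → ℤ → ℂ := fun k l ↦ ∫ t in (0 : ℝ)..T, Complex.exp (Complex.I * t * (w l - w k : ℝ))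
    with hJ
  have hsq (t : ℝ) :
      ((‖∑ k ∈ F, (Complex.exp (Complex.I * t * w k) * c k) • v k‖ ^ 2 : ℝ) : ℂ) =
        ∑ k ∈ F, ∑ l ∈ F, a k l * Complex.exp (Complex.I * t * (w l - w k : ℝ)) := by
    have h := inner_self_eq_norm_sq_to_K (𝕜 := ℂ)
      (∑ k ∈ F, (Complex.exp (Complex.I * t * w k) * c k) • v k)
    push_cast
    refine Eq.trans h.symm ?_
    rw [sum_inner]
    refine Finset.sum_congr rfl fun k _ ↦ ?_
    rw [inner_sum]
    refine Finset.sum_congr rfl fun l _ ↦ ?_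
    rw [inner_smul_left, inner_smul_right, map_mul, ← Complex.exp_conj]
    simp only [ha, map_mul, Complex.conj_I, Complex.conj_ofReal]
    rw [show Complex.I * (t : ℂ) * ((w l : ℂ) - w k) =
      -Complex.I * t * w k + Complex.I * t * w l by ring, Complex.exp_add]
    ring
  have hint : ((∫ t in (0 : ℝ)..T,
      ‖∑ k ∈ F, (Complex.exp (Complex.I * t * w k) * c k) • v k‖ ^ 2 : ℝ) : ℂ) =
        ∑ k ∈ F, ∑ l ∈ F, a k l * J k l := by
    rw [← intervalIntegral.integral_ofReal]
    simp_rw [hsq]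
    rw [intervalIntegral.integral_finsetSum
      fun k _ ↦ Continuous.intervalIntegrable (by fun_prop) _ _]
    refine Finset.sum_congr rfl fun k _ ↦ ?_
    rw [intervalIntegral.integral_finsetSum
      fun k _ ↦ Continuous.intervalIntegrable (by fun_prop) _ _]
    refine Finset.sum_congr rfl fun l _ ↦ ?_
    rw [intervalIntegral.integral_const_mul]
  have hdiag : ((γ * T * ∑ k ∈ F, ‖c k‖ ^ 2 : ℝ) : ℂ) =
      ∑ k ∈ F, ∑ l ∈ F, a k l * (if k = l then (T : ℂ) else 0) := by
    simp only [mul_ite, mul_zero, Finset.sum_ite_eq]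
    push_cast
    rw [Finset.mul_sum]
    refine Finset.sum_congr rfl fun k hk ↦ ?_
    have h1 : inner ℂ (v k) (v k) = (γ : ℂ) := by
      rw [inner_self_eq_norm_sq_to_K, ← hv k]; push_cast; rfl
    rw [if_pos hk, ha]
    simp only [h1]
    rw [← Complex.conj_mul']
    ring
  have hterm : ∀ k ∈ F, ∀ l ∈ F, ‖a k l * (J k l - if k = l then (T : ℂ) else 0)‖ ≤
      4 * γ * ((‖c k‖ / |(k : ℝ)|) * (‖c l‖ / |(l : ℝ)|)) := by
    intro k hk l hl
    by_cases h : k = l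
    · subst h
      simp only [hJ, sub_self]
      simp
      positivity
    have hk0 : (k : ℝ) ≠ 0 := by exact_mod_cast ne_of_mem_of_not_mem hk hF
    have hl0 : (l : ℝ) ≠ 0 := by exact_mod_cast ne_of_mem_of_not_mem hl hF
    have hkl := hw l hl k hk (Ne.symm h)
    have hpos : 0 < |(l : ℝ)| * |(k : ℝ)| / 2 := by positivity
    have hJb : ‖J k l‖ ≤ 4 / (|(l : ℝ)| * |(k : ℝ)|) := by
      refine (norm_intervalIntegral_exp_le T (abs_pos.mp (hpos.trans_le hkl))).trans ?_
      refine (div_le_div_of_nonneg_left zero_le_two hpos hkl).trans (le_of_eq ?_)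
      field_simp
      norm_num
    have hin : ‖inner ℂ (v k) (v l)‖ ≤ γ := by
      refine (norm_inner_le_norm _ _).trans ?_
      nlinarith [sq_nonneg (‖v k‖ - ‖v l‖), hv k, hv l]
    rw [if_neg h, sub_zero, norm_mul, ha]
    simp only [norm_mul, RCLike.norm_conj]
    calc ‖c k‖ * ‖c l‖ * ‖inner ℂ (v k) (v l)‖ * ‖J k l‖
        ≤ ‖c k‖ * ‖c l‖ * γ * (4 / (|(l : ℝ)| * |(k : ℝ)|)) := by gcongr
      _ = _ := by field_simp
  have herr : ‖(∑ k ∈ F, ∑ l ∈ F, a k l * J k l) -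
      ∑ k ∈ F, ∑ l ∈ F, a k l * (if k = l then (T : ℂ) else 0)‖ ≤
        4 * γ * (η * ∑ k ∈ F, ‖c k‖ ^ 2) := by
    simp only [← Finset.sum_sub_distrib, ← mul_sub]
    calc _ ≤ ∑ k ∈ F, ∑ l ∈ F, 4 * γ * ((‖c k‖ / |(k : ℝ)|) * (‖c l‖ / |(l : ℝ)|)) :=
          norm_sum_le_of_le _ fun k hk ↦ norm_sum_le_of_le _ fun l hl ↦ hterm k hk l hl
      _ = 4 * γ * (∑ k ∈ F, 1 / |(k : ℝ)| * ‖c k‖) ^ 2 := by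
          simp only [← Finset.mul_sum, ← Finset.sum_mul, sq]
          congr 2 <;> exact Finset.sum_congr rfl fun k _ ↦ by ring
      _ ≤ 4 * γ * ((∑ k ∈ F, (1 / |(k : ℝ)|) ^ 2) * ∑ k ∈ F, ‖c k‖ ^ 2) := by
          gcongr
          exact Finset.sum_mul_sq_le_sq_mul_sq _ _ _
      _ ≤ _ := by
          have : ∑ k ∈ F, (1 / |(k : ℝ)|) ^ 2 ≤ η := by simpa [div_pow] using hη
          gcongr
  rw [← hint, ← hdiag, ← Complex.ofReal_sub, Complex.norm_real, Real.norm_eq_abs] at herr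
  linarith [(abs_le.mp herr).1]

theorem integral_fourier_mul_conj (j k : ℤ) :
    ∫ x : Torus, fourier k x * (starRingEnd ℂ) (fourier j x) = if j = k then 2 * (π : ℂ) else 0 := by
  have h := orthonormal_iff_ite.mp (orthonormal_fourier (T := 2 * π)) j k
  rw [ContinuousMap.inner_toLp] at h
  rw [AddCircle.volume_eq_smul_haarAddCircle, integral_smul_measure, h,
    ENNReal.toReal_ofReal (by positivity)]
  split_ifs <;> simp

/-- The exponential `x ↦ e^{ikx} / √(2π)` as an element of `L²(𝕋)`. -/
def normalizedFourier (k : ℤ) : L2T :=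
  ((√(2 * π))⁻¹ : ℂ) • ContinuousMap.toLp (E := ℂ) 2 volume ℂ (fourier k)

theorem sqrt_two_pi_ne_zero : ((√(2 * π) : ℝ) : ℂ) ≠ 0 :=
  Complex.ofReal_ne_zero.mpr (by positivity)

theorem sqrt_two_pi_mul_self : ((√(2 * π) : ℝ) : ℂ) * (√(2 * π) : ℝ) = 2 * π := by
  rw [← Complex.ofReal_mul, Real.mul_self_sqrt (by positivity)]
  push_cast
  rfl

theorem orthonormal_normalizedFourier : Orthonormal ℂ normalizedFourier := by
  rw [orthonormal_iff_ite]
  intro j k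
  rw [normalizedFourier, normalizedFourier, inner_smul_left, inner_smul_right,
    ContinuousMap.inner_toLp, integral_fourier_mul_conj, map_inv₀, Complex.conj_ofReal,
    ← sqrt_two_pi_mul_self]
  have := sqrt_two_pi_ne_zero
  split_ifs
  · field_simp
  · simp

theorem span_normalizedFourier_closure_eq_top :
    (Submodule.span ℂ (Set.range normalizedFourier)).topologicalClosure = ⊤ := by
  have h := (ContinuousMap.toLp_denseRange ℂ (volume : Measure Torus) ℂ
    (p := 2) (by norm_num)).topologicalClosure_map_submodule
      (span_fourier_closure_eq_top (T := 2 * π))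
  rw [eq_top_iff, ← h]
  refine Submodule.topologicalClosure_mono ?_
  rw [Submodule.map_span, Submodule.span_le]
  rintro _ ⟨_, ⟨k, rfl⟩, rfl⟩
  have hk := Submodule.smul_mem _ ((√(2 * π) : ℝ) : ℂ)
    (Submodule.subset_span (R := ℂ) (Set.mem_range_self (f := normalizedFourier) k))
  rw [normalizedFourier, smul_inv_smul₀ sqrt_two_pi_ne_zero] at hk
  exact hk

/-- The Hilbert basis of normalized exponentials of `L²(𝕋)`. -/
def torusBasis : HilbertBasis ℤ ℂ L2T :=
  HilbertBasis.mk orthonormal_normalizedFourier span_normalizedFourier_closure_eq_top.ge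

theorem torusBasis_apply (k : ℤ) : torusBasis k = normalizedFourier k := by
  rw [torusBasis, HilbertBasis.coe_mk]

theorem torusBasis_repr (u : L2T) (k : ℤ) :
    torusBasis.repr u k = (√(2 * π) : ℝ) * fc u k := by
  rw [HilbertBasis.repr_apply_apply, torusBasis_apply, normalizedFourier, inner_smul_left, fc,
    L2.inner_def, map_inv₀, Complex.conj_ofReal]
  have h : ∫ x : Torus, inner ℂ (ContinuousMap.toLp (E := ℂ) 2 volume ℂ (fourier k) x) (u x) =
      ∫ x : Torus, fourier (-k) x * u x := by
    refine integral_congr_ae ?_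
    filter_upwards [ContinuousMap.coeFn_toLp (p := 2) (𝕜 := ℂ) (volume : Measure Torus)
      (fourier k)] with x hx
    rw [hx, RCLike.inner_apply, fourier_neg, mul_comm]
  rw [h, ← sqrt_two_pi_mul_self]
  have := sqrt_two_pi_ne_zero
  field_simp

theorem meanZero_iff (u : L2T) : MeanZero u ↔ torusBasis.repr u 0 = 0 := by
  rw [torusBasis_repr, MeanZero, mul_eq_zero, or_iff_right sqrt_two_pi_ne_zero]

theorem HilbertBasis.hasSum_norm_sq_repr {ι E : Type*} [NormedAddCommGroup E]
    [InnerProductSpace ℂ E] (b : HilbertBasis ι ℂ E) (u : E) :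
    HasSum (fun k ↦ ‖b.repr u k‖ ^ 2) (‖u‖ ^ 2) := by
  have h := lp.hasSum_norm (p := 2) (by norm_num) (b.repr u)
  simpa using h

theorem norm_sq_fc (u : L2T) (k : ℤ) :
    ‖torusBasis.repr u k‖ ^ 2 = 2 * π * ‖fc u k‖ ^ 2 := by
  rw [torusBasis_repr, norm_mul, mul_pow, Complex.norm_real, Real.norm_eq_abs, sq_abs,
    Real.sq_sqrt (by positivity)]

theorem Hneg1Sq_nonneg (u : L2T) : 0 ≤ Hneg1Sq u := tsum_nonneg fun k ↦ by positivity

theorem norm_sq_repr_le_Hneg1Sq (u : L2T) (k : ℤ) :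
    ‖torusBasis.repr u k‖ ^ 2 ≤ 2 * π * (1 + (k : ℝ) ^ 2) * Hneg1Sq u := by
  have hs : Summable fun k : ℤ ↦ ‖fc u k‖ ^ 2 := by
    have h := (torusBasis.hasSum_norm_sq_repr u).summable
    simp_rw [norm_sq_fc] at h
    exact (summable_mul_left_iff (by positivity)).mp h
  have hs' : Summable fun k : ℤ ↦ (1 + (k : ℝ) ^ 2)⁻¹ * ‖fc u k‖ ^ 2 := by
    refine hs.of_nonneg_of_le (fun k ↦ by positivity) fun k ↦ ?_
    refine mul_le_of_le_one_left (by positivity) (inv_le_one_of_one_le₀ ?_)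
    nlinarith [sq_nonneg (k : ℝ)]
  have h := hs'.le_tsum k fun j _ ↦ by positivity
  rw [norm_sq_fc]
  calc 2 * π * ‖fc u k‖ ^ 2 =
        2 * π * (1 + (k : ℝ) ^ 2) * ((1 + (k : ℝ) ^ 2)⁻¹ * ‖fc u k‖ ^ 2) := by
        field_simp
    _ ≤ _ := by gcongr; exact h

theorem exists_mul_clm {g : ℝ → ℝ} (hg : Continuous g) (hg_per : Function.Periodic g (2 * π))
    (hg_int : ∫ x in (-π)..π, g x = 1) :
    ∃ G : L2T →L[ℂ] L2T, (∀ v, gMulNormSq hg_per.lift v = ‖G v‖ ^ 2) ∧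
      ∃ γ : ℝ, 0 < γ ∧ ∀ k, ‖G (torusBasis k)‖ ^ 2 = γ := by
  have hlift : Continuous hg_per.lift := hg.quotient_lift _
  let f : C(Torus, ℂ) := ⟨fun x ↦ (hg_per.lift x : ℂ), by fun_prop⟩
  let G : L2T →L[ℂ] L2T := (ContinuousLinearMap.mul ℂ ℂ).holderL volume ⊤ 2 2
    (ContinuousMap.toLp (E := ℂ) ⊤ volume ℂ f)
  have hG (v : L2T) : G v =ᵐ[volume] fun x ↦ (hg_per.lift x : ℂ) * v x := by
    filter_upwards [(ContinuousLinearMap.mul ℂ ℂ).coeFn_holder (r := 2)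
      (ContinuousMap.toLp (E := ℂ) ⊤ volume ℂ f) v,
      ContinuousMap.coeFn_toLp (p := ⊤) (𝕜 := ℂ) (volume : Measure Torus) f] with x hx hx'
    refine hx.trans ?_
    rw [hx']
    rfl
  have hGn (v : L2T) : gMulNormSq hg_per.lift v = ‖G v‖ ^ 2 := by
    have h := L2.inner_def (𝕜 := ℂ) (G v) (G v)
    rw [inner_self_eq_norm_sq_to_K] at h
    simp_rw [inner_self_eq_norm_sq_to_K] at h
    have h2 : ((‖G v‖ ^ 2 : ℝ) : ℂ) = ((∫ x : Torus, ‖G v x‖ ^ 2 : ℝ) : ℂ) := by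
      rw [← integral_complex_ofReal]
      push_cast
      exact h
    rw [Complex.ofReal_inj.mp h2, gMulNormSq]
    refine integral_congr_ae ?_
    filter_upwards [hG v] with x hx
    rw [hx]
  refine ⟨G, hGn, (2 * π)⁻¹ * ∫ x in (-π)..π, g x ^ 2, ?_, fun k ↦ ?_⟩
  · have h : ∫ x in (-π)..π, g x ≤ ∫ x in (-π)..π, (1 / (4 * π) + π * g x ^ 2) := by
      refine intervalIntegral.integral_mono_on (by linarith [Real.pi_pos])
        (hg.intervalIntegrable _ _) (Continuous.intervalIntegrable (by fun_prop) _ _) fun x _ ↦ ?_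
      have h1 : 1 / (4 * π) + π * g x ^ 2 - g x = π * (g x - 1 / (2 * π)) ^ 2 := by
        field_simp
        ring
      have h2 : 0 ≤ π * (g x - 1 / (2 * π)) ^ 2 := by positivity
      linarith
    rw [hg_int, intervalIntegral.integral_add (by simp)
      (Continuous.intervalIntegrable (by fun_prop) _ _), intervalIntegral.integral_const,
      intervalIntegral.integral_const_mul, smul_eq_mul,
      show (π - -π) * (1 / (4 * π)) = 1 / 2 by field_simp; norm_num] at h
    have : 0 < ∫ x in (-π)..π, g x ^ 2 := pos_of_mul_pos_right (by linarith) Real.pi_pos.le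
    positivity
  · rw [← hGn, gMulNormSq]
    have h : ∫ x : Torus, ‖(hg_per.lift x : ℂ) * torusBasis k x‖ ^ 2 =
        ∫ x : Torus, (2 * π)⁻¹ * (hg_per.lift x) ^ 2 := by
      refine integral_congr_ae ?_
      rw [torusBasis_apply, normalizedFourier]
      filter_upwards [Lp.coeFn_smul ((√(2 * π))⁻¹ : ℂ)
        (ContinuousMap.toLp (E := ℂ) 2 (volume : Measure Torus) ℂ (fourier k)),
        ContinuousMap.coeFn_toLp (p := 2) (𝕜 := ℂ) (volume : Measure Torus)
        (fourier k)] with x hx hx'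
      rw [hx, Pi.smul_apply, hx', fourier_apply]
      simp only [smul_eq_mul, norm_mul, Circle.norm_coe, norm_inv, Complex.norm_real,
        Real.norm_eq_abs, mul_pow, inv_pow, sq_abs]
      rw [Real.sq_sqrt (by positivity)]
      ring
    rw [h, integral_const_mul,
      ← AddCircle.intervalIntegral_preimage (2 * π) (-π) fun x ↦ hg_per.lift x ^ 2]
    rw [show -π + 2 * π = π by ring]
    rfl

/-- The symbol `k³ - λ²/k` of the group `S_λ`. -/
def phase (lam : ℝ) (k : ℤ) : ℝ := (k : ℝ) ^ 3 - lam ^ 2 / k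

theorem IsLamGroup.repr_apply {lam : ℝ} {S : ℝ → L2T →L[ℂ] L2T} {u : L2T}
    (hS : IsLamGroup lam S) (hu : MeanZero u) (t : ℝ) (k : ℤ) :
    torusBasis.repr (S t u) k =
      Complex.exp (Complex.I * t * phase lam k) * torusBasis.repr u k := by
  obtain ⟨h0, h⟩ := hS t u hu
  by_cases hk : k = 0
  · subst hk
    rw [(meanZero_iff _).mp h0, (meanZero_iff _).mp hu, mul_zero]
  · rw [torusBasis_repr, torusBasis_repr, h k hk, phase]
    push_cast
    ring

theorem norm_exp_I_mul_mul (t w : ℝ) : ‖Complex.exp (Complex.I * t * w)‖ = 1 := by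
  rw [show Complex.I * (t : ℂ) * w = ((t * w : ℝ) : ℂ) * Complex.I by push_cast; ring,
    Complex.norm_exp_ofReal_mul_I]

theorem IsLamGroup.norm_repr_apply {lam : ℝ} {S : ℝ → L2T →L[ℂ] L2T} {u : L2T}
    (hS : IsLamGroup lam S) (hu : MeanZero u) (t : ℝ) (k : ℤ) :
    ‖torusBasis.repr (S t u) k‖ = ‖torusBasis.repr u k‖ := by
  rw [hS.repr_apply hu, norm_mul, norm_exp_I_mul_mul, one_mul]

theorem IsLamGroup.norm_apply {lam : ℝ} {S : ℝ → L2T →L[ℂ] L2T} {u : L2T}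
    (hS : IsLamGroup lam S) (hu : MeanZero u) (t : ℝ) :
    ‖S t u‖ = ‖u‖ := by
  have h1 := torusBasis.hasSum_norm_sq_repr (S t u)
  simp_rw [hS.norm_repr_apply hu] at h1
  exact (pow_left_inj₀ (norm_nonneg _) (norm_nonneg _) two_ne_zero).mp
    (h1.unique (torusBasis.hasSum_norm_sq_repr u))

theorem IsLamGroup.Hneg1Sq_apply {lam : ℝ} {S : ℝ → L2T →L[ℂ] L2T} {u : L2T}
    (hS : IsLamGroup lam S) (hu : MeanZero u) (t : ℝ) :
    Hneg1Sq (S t u) = Hneg1Sq u := by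
  refine tsum_congr fun k ↦ ?_
  have h : 2 * π * ‖fc (S t u) k‖ ^ 2 = 2 * π * ‖fc u k‖ ^ 2 := by
    rw [← norm_sq_fc, ← norm_sq_fc, hS.norm_repr_apply hu]
  rw [mul_left_cancel₀ (by positivity) h]

theorem IsLamGroup.apply_apply {lam : ℝ} {S : ℝ → L2T →L[ℂ] L2T} {u : L2T}
    (hS : IsLamGroup lam S) (hu : MeanZero u) (t s : ℝ) :
    S t (S s u) = S (t + s) u := by
  apply torusBasis.repr.injective
  ext k
  rw [hS.repr_apply (hS s u hu).1, hS.repr_apply hu, hS.repr_apply hu, ← mul_assoc,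
    ← Complex.exp_add]
  push_cast
  ring_nf

theorem IsLamGroup.apply_torusBasis {lam : ℝ} {S : ℝ → L2T →L[ℂ] L2T}
    (hS : IsLamGroup lam S) {k : ℤ} (hk : k ≠ 0) (t : ℝ) :
    S t (torusBasis k) = Complex.exp (Complex.I * t * phase lam k) • torusBasis k := by
  have hmean : MeanZero (torusBasis k) := by
    rw [meanZero_iff, HilbertBasis.repr_self, lp.single_apply_ne _ _ _ hk.symm]
  apply torusBasis.repr.injective
  ext j
  rw [hS.repr_apply hmean, map_smul, lp.coeFn_smul, Pi.smul_apply, smul_eq_mul,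
    HilbertBasis.repr_self]
  by_cases hj : j = k
  · rw [hj]
  · rw [lp.single_apply_ne _ _ _ hj, mul_zero, mul_zero]

theorem IsLamGroup.continuous_apply {lam : ℝ} {S : ℝ → L2T →L[ℂ] L2T} {u : L2T}
    (hS : IsLamGroup lam S) (hu : MeanZero u) :
    Continuous fun t ↦ S t u := by
  rw [continuous_iff_continuousAt]
  intro t₀
  set f : ℤ → ℝ → ℝ := fun k t ↦ ‖(Complex.exp (Complex.I * t * phase lam k) -
    Complex.exp (Complex.I * t₀ * phase lam k)) * torusBasis.repr u k‖ ^ 2 with hf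
  have hcont : Continuous fun t ↦ ∑' k, f k t := by
    refine continuous_tsum (fun k ↦ by fun_prop)
      ((torusBasis.hasSum_norm_sq_repr u).summable.mul_left 4) fun k t ↦ ?_
    have h2 : ‖Complex.exp (Complex.I * t * phase lam k) -
        Complex.exp (Complex.I * t₀ * phase lam k)‖ ≤ 2 := by
      refine (norm_sub_le _ _).trans (le_of_eq ?_)
      rw [norm_exp_I_mul_mul, norm_exp_I_mul_mul]
      norm_num
    rw [hf]
    simp only [norm_mul, norm_pow, norm_norm, mul_pow]
    gcongr
    calc _ ≤ (2 : ℝ) ^ 2 := by gcongr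
      _ = 4 := by norm_num
  have hnorm (t : ℝ) : ‖S t u - S t₀ u‖ = √(∑' k, f k t) := by
    have h := torusBasis.hasSum_norm_sq_repr (S t u - S t₀ u)
    simp only [map_sub, lp.coeFn_sub, Pi.sub_apply, hS.repr_apply hu, ← sub_mul] at h
    rw [h.tsum_eq, Real.sqrt_sq (norm_nonneg _)]
  rw [ContinuousAt, tendsto_iff_norm_sub_tendsto_zero]
  simp_rw [hnorm]
  have h := (Real.continuous_sqrt.comp hcont).tendsto t₀
  have h0 : (∑' k, f k t₀) = 0 := by simp [hf]
  simpa [Function.comp_def, h0] using h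

theorem HilbertBasis.norm_sq_sub_sum_repr {ι E : Type*} [NormedAddCommGroup E]
    [InnerProductSpace ℂ E] (b : HilbertBasis ι ℂ E) (u : E) (F : Finset ι) :
    ‖u - ∑ k ∈ F, b.repr u k • b k‖ ^ 2 = ‖u‖ ^ 2 - ∑ k ∈ F, ‖b.repr u k‖ ^ 2 := by
  have h1 : inner ℂ u (∑ k ∈ F, b.repr u k • b k) = ((∑ k ∈ F, ‖b.repr u k‖ ^ 2 : ℝ) : ℂ) := by
    rw [inner_sum]
    push_cast
    refine Finset.sum_congr rfl fun k _ ↦ ?_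
    rw [inner_smul_right, ← inner_conj_symm, ← HilbertBasis.repr_apply_apply, Complex.mul_conj']
  have h2 : ‖∑ k ∈ F, b.repr u k • b k‖ ^ 2 = ∑ k ∈ F, ‖b.repr u k‖ ^ 2 := by
    have h := inner_self_eq_norm_sq_to_K (𝕜 := ℂ) (∑ k ∈ F, b.repr u k • b k)
    rw [b.orthonormal.inner_sum] at h
    simp_rw [Complex.conj_mul'] at h
    have h' : ((‖∑ k ∈ F, b.repr u k • b k‖ ^ 2 : ℝ) : ℂ) =
        ((∑ k ∈ F, ‖b.repr u k‖ ^ 2 : ℝ) : ℂ) := by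
      push_cast
      exact h.symm
    exact Complex.ofReal_inj.mp h'
  rw [norm_sub_sq (𝕜 := ℂ), h1, h2, RCLike.re_to_complex, Complex.ofReal_re]
  ring

theorem weak_observability_of_le {G : L2T →L[ℂ] L2T} {γ : ℝ} (hγ : 0 < γ)
    (hG : ∀ k, ‖G (torusBasis k)‖ ^ 2 = γ) {T : ℝ} (hT : 0 < T) (Λ : ℝ) :
    ∃ C : ℝ, 0 < C ∧ ∀ lam : ℝ, 0 ≤ lam → lam ≤ Λ → ∀ S : ℝ → L2T →L[ℂ] L2T, IsLamGroup lam S →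
      ∀ u : L2T, MeanZero u →
        ‖u‖ ^ 2 ≤ C * (∫ t in (0 : ℝ)..T, ‖G (S t u)‖ ^ 2) + C * Hneg1Sq u := by
  classical
  obtain ⟨s₀, hs₀⟩ := summable_iff_vanishing_norm.mp
    ((Real.summable_one_div_int_pow (p := 2)).mpr one_lt_two) (T / 8) (by positivity)
  obtain ⟨M, hM⟩ := exists_nat_ge (2 * Λ ^ 2)
  set s : Finset ℤ := s₀ ∪ Finset.Icc (-(M : ℤ)) M with hs
  have hs_zero : (0 : ℤ) ∈ s := by simp [hs]
  have hs_large {k : ℤ} (hk : k ∉ s) : 2 * Λ ^ 2 ≤ (k : ℝ) ^ 2 := by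
    have h1 : (M : ℤ) ≤ |k| := by
      simp only [hs, Finset.mem_union, Finset.mem_Icc, not_or, ← abs_le] at hk
      exact (not_le.mp hk.2).le
    have h2 : (M : ℤ) ≤ k ^ 2 := by
      rw [← sq_abs]
      nlinarith [Int.natCast_nonneg M]
    exact hM.trans (by exact_mod_cast h2)
  set A : ℝ := 2 / (γ * T) with hA
  set B : ℝ := 1 + 2 * A * T * ‖G‖ ^ 2 with hB
  set L : ℝ := ∑ k ∈ s, 2 * π * (1 + (k : ℝ) ^ 2) with hL
  have hA0 : 0 < A := by positivity
  have hB0 : 0 ≤ B := by positivity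
  have hL0 : 0 ≤ L := Finset.sum_nonneg fun k _ ↦ by positivity
  refine ⟨2 * A + B * L, by positivity, fun lam hlam0 hlam S hS u hu ↦ ?_⟩
  set I : ℝ := ∫ t in (0 : ℝ)..T, ‖G (S t u)‖ ^ 2 with hI
  have hI0 : 0 ≤ I := intervalIntegral.integral_nonneg hT.le fun t _ ↦ by positivity
  have hScont := hS.continuous_apply hu
  have key (F : Finset ℤ) : ‖u‖ ^ 2 ≤ 2 * A * I + B * (‖u‖ ^ 2 -
      ∑ k ∈ F, ‖torusBasis.repr u k‖ ^ 2 + ∑ k ∈ s, ‖torusBasis.repr u k‖ ^ 2) := by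
    set w : L2T := ∑ k ∈ F \ s, torusBasis.repr u k • torusBasis k with hw
    set d : ℝ := ‖u‖ ^ 2 - ∑ k ∈ F \ s, ‖torusBasis.repr u k‖ ^ 2 with hd
    have hd_eq : ‖u - w‖ ^ 2 = d := torusBasis.norm_sq_sub_sum_repr u (F \ s)
    have hmean : MeanZero (u - w) := by
      have h0 : torusBasis.repr w 0 = 0 := by
        rw [hw, HilbertBasis.repr_apply_apply, inner_sum]
        refine Finset.sum_eq_zero fun k hk ↦ ?_
        have hk0 : (0 : ℤ) ≠ k := fun h ↦ (Finset.mem_sdiff.mp hk).2 (h ▸ hs_zero)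
        rw [inner_smul_right, torusBasis.orthonormal.2 hk0, mul_zero]
      rw [meanZero_iff, map_sub, lp.coeFn_sub, Pi.sub_apply, h0, (meanZero_iff u).mp hu, sub_zero]
    have hSw (t : ℝ) : G (S t w) = ∑ k ∈ F \ s, (Complex.exp (Complex.I * t * phase lam k) *
        torusBasis.repr u k) • G (torusBasis k) := by
      rw [hw, map_sum, map_sum]
      refine Finset.sum_congr rfl fun k hk ↦ ?_
      have hk0 : k ≠ 0 := fun h ↦ (Finset.mem_sdiff.mp hk).2 (h ▸ hs_zero)
      rw [map_smul, hS.apply_torusBasis hk0, map_smul, map_smul, smul_smul,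
        mul_comm (torusBasis.repr u k)]
    have hlow := integral_norm_sq_exp_sum_lower_bound (F \ s) (fun k ↦ torusBasis.repr u k)
      (fun k ↦ G (torusBasis k)) (phase lam) (η := T / 8) (T := T) hG
      (fun h ↦ (Finset.mem_sdiff.mp h).2 hs_zero)
      (fun k hk l hl hkl ↦ half_mul_abs_le_abs_phase_sub hkl
        (fun h ↦ (Finset.mem_sdiff.mp hk).2 (h ▸ hs_zero))
        (fun h ↦ (Finset.mem_sdiff.mp hl).2 (h ▸ hs_zero))
        (le_trans (by gcongr) (hs_large (Finset.mem_sdiff.mp hk).2)))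
      ((le_abs_self _).trans (hs₀ (F \ s) (Finset.disjoint_of_subset_right
        Finset.subset_union_left Finset.sdiff_disjoint)).le)
    simp_rw [← hSw] at hlow
    have hup : ∫ t in (0 : ℝ)..T, ‖G (S t w)‖ ^ 2 ≤
        ∫ t in (0 : ℝ)..T, (2 * ‖G (S t u)‖ ^ 2 + 2 * ‖G‖ ^ 2 * d) := by
      refine intervalIntegral.integral_mono_on hT.le
        (Continuous.intervalIntegrable (by simp_rw [hSw]; fun_prop) _ _)
        (Continuous.intervalIntegrable (by fun_prop) _ _) fun t _ ↦ ?_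
      have h1 : ‖G (S t (u - w))‖ ≤ ‖G‖ * ‖u - w‖ := by
        rw [← hS.norm_apply hmean t]
        exact G.le_opNorm _
      have h2 : ‖G (S t w)‖ ≤ ‖G (S t u)‖ + ‖G‖ * ‖u - w‖ := by
        have h3 : G (S t w) = G (S t u) - G (S t (u - w)) := by simp
        rw [h3]
        exact (norm_sub_le _ _).trans (by gcongr)
      rw [← hd_eq]
      have h4 : ‖G (S t w)‖ ^ 2 ≤ (‖G (S t u)‖ + ‖G‖ * ‖u - w‖) ^ 2 := by gcongr
      nlinarith [sq_nonneg (‖G (S t u)‖ - ‖G‖ * ‖u - w‖)]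
    rw [intervalIntegral.integral_add (Continuous.intervalIntegrable (by fun_prop) _ _) (by simp),
      intervalIntegral.integral_const, intervalIntegral.integral_const_mul, ← hI, smul_eq_mul,
      sub_zero] at hup
    have hhigh : ∑ k ∈ F \ s, ‖torusBasis.repr u k‖ ^ 2 ≤
        A * (2 * I + T * (2 * ‖G‖ ^ 2 * d)) := by
      calc _ = A * (γ * (T - 4 * (T / 8)) * ∑ k ∈ F \ s, ‖torusBasis.repr u k‖ ^ 2) := by
            rw [hA]; field_simp; ring
        _ ≤ _ := by gcongr; exact hlow.trans hup
    have hd_le : d ≤ ‖u‖ ^ 2 - ∑ k ∈ F, ‖torusBasis.repr u k‖ ^ 2 +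
        ∑ k ∈ s, ‖torusBasis.repr u k‖ ^ 2 := by
      have h1 : ∑ k ∈ F, ‖torusBasis.repr u k‖ ^ 2 ≤
          ∑ k ∈ (F \ s) ∪ s, ‖torusBasis.repr u k‖ ^ 2 :=
        Finset.sum_le_sum_of_subset_of_nonneg (by simp) fun k _ _ ↦ by positivity
      rw [Finset.sum_union Finset.sdiff_disjoint] at h1
      linarith
    calc ‖u‖ ^ 2 ≤ 2 * A * I + B * d := by rw [hB]; linarith
      _ ≤ _ := by gcongr
  have hlim : Tendsto (fun F : Finset ℤ ↦ 2 * A * I + B * (‖u‖ ^ 2 -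
      ∑ k ∈ F, ‖torusBasis.repr u k‖ ^ 2 + ∑ k ∈ s, ‖torusBasis.repr u k‖ ^ 2)) atTop
      (nhds (2 * A * I + B * (‖u‖ ^ 2 - ‖u‖ ^ 2 + ∑ k ∈ s, ‖torusBasis.repr u k‖ ^ 2))) :=
    ((((torusBasis.hasSum_norm_sq_repr u).const_sub _).add_const _).const_mul _).const_add _
  have h1 := ge_of_tendsto' hlim key
  have h2 : ∑ k ∈ s, ‖torusBasis.repr u k‖ ^ 2 ≤ L * Hneg1Sq u := by
    rw [hL, Finset.sum_mul]
    exact Finset.sum_le_sum fun k _ ↦ norm_sq_repr_le_Hneg1Sq u k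
  rw [sub_self, zero_add] at h1
  have h3 := mul_le_mul_of_nonneg_left h2 hB0
  nlinarith [mul_nonneg hA0.le (Hneg1Sq_nonneg u), mul_nonneg (mul_nonneg hB0 hL0) hI0]

theorem IsLamGroup.isSemiGroup {lam : ℝ} {S : ℝ → L2T →L[ℂ] L2T}
    (hlam : 0 < lam) (hS : IsLamGroup lam S) :
    IsSemiGroup (1 / √lam) fun t ↦ S (t / lam) := by
  intro t u hu
  refine ⟨(hS _ u hu).1, fun k hk ↦ ?_⟩
  rw [(hS _ u hu).2 k hk]
  have h : ((1 / √lam : ℝ) : ℂ) ^ 2 = 1 / (lam : ℂ) := by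
    rw [← Complex.ofReal_pow, div_pow, one_pow, Real.sq_sqrt hlam.le]
    push_cast
    rfl
  have hk' : (k : ℂ) ≠ 0 := by exact_mod_cast hk
  have hl' : (lam : ℂ) ≠ 0 := by exact_mod_cast hlam.ne'
  rw [h]
  congr 2
  push_cast
  field_simp

theorem weak_observability_of_ge {lam : ℝ} {S : ℝ → L2T →L[ℂ] L2T} {u : L2T}
    {G : L2T →L[ℂ] L2T} {T₀ C T : ℝ}
    (hT₀ : 0 < T₀) (hC : 0 < C)
    (hT : 0 < T) (hlam : 0 < lam) (hlamT : T₀ ≤ T * lam)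
    (hS : IsLamGroup lam S)
    (hsemi : ∀ u : L2T, MeanZero u → ‖u‖ ^ 2 ≤
      C * (∫ t in (0 : ℝ)..T₀, ‖G (S (t / lam) u)‖ ^ 2) + C * Hneg1Sq u)
    (hu : MeanZero u) :
    ‖u‖ ^ 2 ≤ C * (2 * T₀ / T) * (∫ t in (0 : ℝ)..T, ‖G (S t u)‖ ^ 2) + C * Hneg1Sq u := by
  have hScont := hS.continuous_apply hu
  have hint (a b : ℝ) : IntervalIntegrable (fun t ↦ ‖G (S t u)‖ ^ 2) volume a b :=
    Continuous.intervalIntegrable (by fun_prop) _ _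
  set δ : ℝ := T₀ / lam with hδ
  have hδ0 : 0 < δ := by positivity
  have hδT : δ ≤ T := by rwa [hδ, div_le_iff₀ hlam]
  set N : ℕ := ⌊T / δ⌋₊ with hN
  have hN1 : (1 : ℝ) ≤ N := by
    have : 1 ≤ N := Nat.le_floor (by rw [Nat.cast_one]; exact (one_le_div hδ0).mpr hδT)
    exact_mod_cast this
  have hN_le : N * δ ≤ T := (le_div_iff₀ hδ0).mp (Nat.floor_le (by positivity))
  have hN_ge : T ≤ 2 * N * δ := by
    have h := Nat.lt_floor_add_one (T / δ)
    rw [div_lt_iff₀ hδ0, ← hN] at h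
    nlinarith
  have hstep (j : ℕ) : ‖u‖ ^ 2 ≤
      C * (lam * ∫ t in (j * δ)..((j + 1 : ℕ) * δ), ‖G (S t u)‖ ^ 2) + C * Hneg1Sq u := by
    have h := hsemi (S (j * δ) u) (hS _ u hu).1
    rw [hS.norm_apply hu, hS.Hneg1Sq_apply hu] at h
    simp_rw [hS.apply_apply hu] at h
    rw [intervalIntegral.integral_comp_div_add (fun t ↦ ‖G (S t u)‖ ^ 2) hlam.ne', zero_div,
      zero_add, ← hδ, smul_eq_mul] at h
    rwa [show ((j + 1 : ℕ) : ℝ) * δ = δ + j * δ by push_cast; ring]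
  have hsum := Finset.sum_le_sum fun j (_ : j ∈ Finset.range N) ↦ hstep j
  rw [Finset.sum_add_distrib, ← Finset.mul_sum, ← Finset.mul_sum,
    intervalIntegral.sum_integral_adjacent_intervals (a := fun j : ℕ ↦ (j : ℝ) * δ)
      fun k _ ↦ hint _ _] at hsum
  simp only [Finset.sum_const, Finset.card_range, nsmul_eq_mul, Nat.cast_zero, zero_mul] at hsum
  have hmono : ∫ t in (0 : ℝ)..(N * δ), ‖G (S t u)‖ ^ 2 ≤ ∫ t in (0 : ℝ)..T, ‖G (S t u)‖ ^ 2 :=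
    intervalIntegral.integral_mono_interval le_rfl (by positivity) hN_le
      (ae_of_all _ fun t ↦ by positivity) (hint _ _)
  set I : ℝ := ∫ t in (0 : ℝ)..T, ‖G (S t u)‖ ^ 2
  have hI0 : 0 ≤ I := intervalIntegral.integral_nonneg hT.le fun t _ ↦ by positivity
  have hlamN : lam ≤ N * (2 * T₀ / T) := by
    rw [mul_div_assoc', le_div_iff₀ hT]
    calc lam * T ≤ lam * (2 * N * δ) := by gcongr
      _ = N * (2 * T₀) := by rw [hδ]; field_simp
  refine le_of_mul_le_mul_left ?_ (zero_lt_one.trans_le hN1)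
  calc N * ‖u‖ ^ 2 ≤ C * (lam * I) + N * (C * Hneg1Sq u) := hsum.trans (by gcongr)
    _ ≤ C * (N * (2 * T₀ / T) * I) + N * (C * Hneg1Sq u) := by gcongr
    _ = _ := by ring

/-- Proposition 3.7, semiclassical reduction: if the semiclassical weak
observability inequality holds for some `T₀ > 0` uniformly in `h ∈ (0,1)`, then for every
`T > 0` the weak observability inequality holds uniformly in `λ ≥ 0`. -/
theorem semiclassical_observability_implies_weak_observability
    -- `g` is a fixed real-valued C² function on `𝕋` (2π-periodic on `ℝ`), nonnegative,
    -- with integral 1, vanishing outside `(a,b) ⊂ (-π,π)`: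
    (g : ℝ → ℝ) (hg_reg : ContDiff ℝ 2 g) (hg_per : Function.Periodic g (2 * Real.pi))
    (hg_nonneg : ∀ x, 0 ≤ g x)
    (a b : ℝ) (ha : -Real.pi < a) (hab : a < b) (hb : b < Real.pi)
    (hg_supp : ∀ x ∈ Set.Ioc (-Real.pi) Real.pi, g x ≠ 0 → x ∈ Set.Ioo a b)
    (hg_int : ∫ x in (-Real.pi)..Real.pi, g x = 1)
    (hsemi : ∃ T₀ : ℝ, 0 < T₀ ∧ ∃ C : ℝ, 0 < C ∧
      ∀ h : ℝ, h ∈ Set.Ioo (0:ℝ) 1 →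
        ∀ S : ℝ → L2T →L[ℂ] L2T, IsSemiGroup h S →
          ∀ u₀ : L2T, MeanZero u₀ →
            ‖u₀‖ ^ 2 ≤ C * (∫ t in (0:ℝ)..T₀, gMulNormSq hg_per.lift (S t u₀))
              + C * Hneg1Sq u₀) :
    ∀ T : ℝ, 0 < T →
      ∃ C' : ℝ, 0 < C' ∧
        ∀ lam : ℝ, 0 ≤ lam →
          ∀ S : ℝ → L2T →L[ℂ] L2T, IsLamGroup lam S →
            ∀ u₀ : L2T, MeanZero u₀ →
              ‖u₀‖ ^ 2 ≤ C' * (∫ t in (0:ℝ)..T, gMulNormSq hg_per.lift (S t u₀))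
                + C' * Hneg1Sq u₀ := by
  intro T hT
  obtain ⟨T₀, hT₀, C, hC, hsemi⟩ := hsemi
  obtain ⟨G, hG, γ, hγ, hGγ⟩ := exists_mul_clm hg_reg.continuous hg_per hg_int
  simp_rw [hG] at hsemi ⊢
  obtain ⟨C₁, hC₁, hlow⟩ := weak_observability_of_le hγ hGγ hT (max 1 (T₀ / T))
  refine ⟨C₁ + C * (2 * T₀ / T) + C, by positivity, fun lam hlam S hS u hu ↦ ?_⟩
  have hI : 0 ≤ ∫ t in (0 : ℝ)..T, ‖G (S t u)‖ ^ 2 :=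
    intervalIntegral.integral_nonneg hT.le fun t _ ↦ by positivity
  have hH := Hneg1Sq_nonneg u
  rcases le_or_gt lam (max 1 (T₀ / T)) with h | h
  · refine (hlow lam hlam h S hS u hu).trans ?_
    gcongr <;> rw [add_assoc] <;> exact le_add_of_nonneg_right (by positivity)
  · obtain ⟨h1, h2⟩ := max_lt_iff.mp h
    have hlam0 : 0 < lam := zero_lt_one.trans h1
    have hh : 1 / √lam ∈ Set.Ioo (0 : ℝ) 1 := by
      refine ⟨by positivity, ?_⟩
      rw [div_lt_one (by positivity), Real.lt_sqrt zero_le_one]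
      simpa using h1
    refine (weak_observability_of_ge hT₀ hC hT hlam0 ((div_lt_iff₀' hT).mp h2).le hS
      (hsemi _ hh _ (hS.isSemiGroup hlam0)) hu).trans ?_
    have : 0 ≤ C * (2 * T₀ / T) := by positivity
    gcongr <;> linarith
end
end

section
/- Let ψ ∈ C_c^∞(ℝ) with supp ψ ⊂ {1/2 ≤ |ξ| ≤ 2}, and for k ∈ ℤ set ψ_k(ξ) = ψ(2^k ξ). There exist ε₀ ∈ (0,1), h₀ ∈ (0,1), T₀ > 0 and C₀ > 0 such that for every k ∈ ℤ and every h ∈ (0,h₀) with 2^k h ≤ ε₀, the frequency-localized observability inequality ‖ψ_k(hDₓ)u₀‖²_{L²(𝕋)} ≤ C₀ ∫₀^{T₀} ‖g · ψ_k(hDₓ)(Sʰ(t)u₀)‖²_{L²(𝕋)} dt holds for all u₀ ∈ L²₀(𝕋). -/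
open MeasureTheory Real Filter

noncomputable section

open scoped ComplexConjugate

/-- Schur's test for a nonnegative even convolution kernel on a finite set of integers. -/
lemma schur_sum_le (F : Finset ℤ) (c : ℤ → ℂ) {p : ℤ → ℝ} (hp : ∀ j, 0 ≤ p j)
    (heven : ∀ j, p (-j) = p j) (hs : Summable p) :
    ∑ n ∈ F, ∑ m ∈ F, ‖c n‖ * ‖c m‖ * p (n - m) ≤ (∑' j, p j) * ∑ n ∈ F, ‖c n‖ ^ 2 := by
  have row : ∀ n, ∑ m ∈ F, p (n - m) ≤ ∑' j, p j := fun n => by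
    rw [← (Equiv.subLeft n).tsum_eq p]
    exact Summable.sum_le_tsum F (fun _ _ => hp _) ((Equiv.subLeft n).summable_iff.2 hs)
  have half : ∑ n ∈ F, ∑ m ∈ F, ‖c n‖ ^ 2 * p (n - m) ≤
      (∑' j, p j) * ∑ n ∈ F, ‖c n‖ ^ 2 := by
    rw [Finset.mul_sum]
    refine Finset.sum_le_sum fun n _ => ?_
    rw [← Finset.mul_sum, mul_comm]
    exact mul_le_mul_of_nonneg_right (row n) (sq_nonneg _)
  have half' : ∑ n ∈ F, ∑ m ∈ F, ‖c m‖ ^ 2 * p (n - m) =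
      ∑ n ∈ F, ∑ m ∈ F, ‖c n‖ ^ 2 * p (n - m) := by
    rw [Finset.sum_comm]
    refine Finset.sum_congr rfl fun n _ => Finset.sum_congr rfl fun m _ => ?_
    rw [← heven (n - m), neg_sub]
  have amgm : ∑ n ∈ F, ∑ m ∈ F, ‖c n‖ * ‖c m‖ * p (n - m) ≤
      ∑ n ∈ F, ∑ m ∈ F, (‖c n‖ ^ 2 * p (n - m) + ‖c m‖ ^ 2 * p (n - m)) / 2 := by
    refine Finset.sum_le_sum fun n _ => Finset.sum_le_sum fun m _ => ?_
    nlinarith [mul_nonneg (sq_nonneg (‖c n‖ - ‖c m‖)) (hp (n - m))]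
  simp only [← Finset.sum_div, Finset.sum_add_distrib] at amgm
  linarith

/-- A Hermitian-type form with constant diagonal `d` and off-diagonal entries dominated by an even
summable convolution kernel is bounded below. -/
lemma le_re_sum_of_offDiag_le (F : Finset ℤ) (c : ℤ → ℂ) (H : ℤ → ℤ → ℂ) {p : ℤ → ℝ}
    (hp : ∀ j, 0 ≤ p j) (heven : ∀ j, p (-j) = p j) (hs : Summable p) {d η : ℝ} (hη : 0 ≤ η)
    (hdiag : ∀ n ∈ F, H n n = d)
    (hoff : ∀ n ∈ F, ∀ m ∈ F, n ≠ m → ‖H n m‖ ≤ η * p (n - m)) :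
    (d - η * ∑' j, p j) * ∑ n ∈ F, ‖c n‖ ^ 2 ≤
      (∑ n ∈ F, ∑ m ∈ F, c n * conj (c m) * H n m).re := by
  have key : ∑ n ∈ F, ∑ m ∈ F,
      ((if n = m then d * ‖c n‖ ^ 2 else 0) - η * (‖c n‖ * ‖c m‖ * p (n - m))) ≤
      (∑ n ∈ F, ∑ m ∈ F, c n * conj (c m) * H n m).re := by
    rw [Complex.re_sum]
    refine Finset.sum_le_sum fun n hn => ?_
    rw [Complex.re_sum]
    refine Finset.sum_le_sum fun m hm => ?_
    split_ifs with h
    · subst h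
      rw [hdiag n hn, Complex.mul_conj, Complex.normSq_eq_norm_sq, ← Complex.ofReal_mul,
        Complex.ofReal_re]
      have := mul_nonneg hη (mul_nonneg (mul_nonneg (norm_nonneg (c n)) (norm_nonneg (c n)))
        (hp (n - n)))
      linarith
    · have h1 : ‖c n * conj (c m) * H n m‖ ≤ η * (‖c n‖ * ‖c m‖ * p (n - m)) := by
        rw [norm_mul, norm_mul, RCLike.norm_conj]
        calc _ ≤ ‖c n‖ * ‖c m‖ * (η * p (n - m)) := by gcongr; exact hoff n hn m hm h
          _ = _ := by ring
      have h2 := (abs_le.1 (Complex.abs_re_le_norm (c n * conj (c m) * H n m))).1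
      linarith
  have hsum : ∑ n ∈ F, ∑ m ∈ F,
      ((if n = m then d * ‖c n‖ ^ 2 else 0) - η * (‖c n‖ * ‖c m‖ * p (n - m))) =
      d * ∑ n ∈ F, ‖c n‖ ^ 2 - η * ∑ n ∈ F, ∑ m ∈ F, ‖c n‖ * ‖c m‖ * p (n - m) := by
    simp only [Finset.sum_sub_distrib, Finset.mul_sum]
    congr 1
    refine Finset.sum_congr rfl fun n hn => ?_
    rw [Finset.sum_ite_eq, if_pos hn]
  have := mul_le_mul_of_nonneg_left (schur_sum_le F c hp heven hs) hη
  rw [hsum] at key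
  linarith

/-- Two integrations by parts in an oscillatory integral whose amplitude vanishes at both ends. -/
lemma norm_integral_mul_exp_le {f f' f'' : ℝ → ℝ} {a b : ℝ} (hab : a ≤ b)
    (hf : ∀ x, HasDerivAt f (f' x) x) (hf' : ∀ x, HasDerivAt f' (f'' x) x)
    (hf'' : Continuous f'') (ha : f a = 0) (hb : f b = 0) {ω : ℝ} (hω : ω ≠ 0) :
    ‖∫ x in a..b, (f x : ℂ) * Complex.exp (Complex.I * ω * x)‖ ≤
      (|f' a| + |f' b| + ∫ x in a..b, |f'' x|) / ω ^ 2 := by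
  have hω' : (ω : ℂ) ≠ 0 := by exact_mod_cast hω
  have hcf : Continuous f := continuous_iff_continuousAt.2 fun x => (hf x).continuousAt
  set E : ℝ → ℂ := fun x => Complex.exp (Complex.I * ω * x) with hE
  have hEn : ∀ x, ‖E x‖ = 1 := fun x => by
    rw [hE]
    simp only
    rw [show Complex.I * ω * x = ((ω * x : ℝ) : ℂ) * Complex.I by push_cast; ring]
    exact Complex.norm_exp_ofReal_mul_I _
  have hEc : Continuous E := by fun_prop
  have hEd : ∀ x : ℝ, HasDerivAt E (E x * (Complex.I * ω)) x := fun x => by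
    have h := ((Complex.ofRealCLM.hasDerivAt (x := x)).const_mul (Complex.I * ω)).cexp
    simpa using h
  have hd : ∀ x : ℝ, HasDerivAt
      (fun x => E x * ((f x : ℂ) / (Complex.I * ω) + (f' x : ℂ) / (ω : ℂ) ^ 2))
      ((f x : ℂ) * E x + (f'' x : ℂ) * E x / (ω : ℂ) ^ 2) x := fun x => by
    have h := (hEd x).mul (((hf x).ofReal_comp.div_const (Complex.I * ω)).add
      ((hf' x).ofReal_comp.div_const ((ω : ℂ) ^ 2)))
    refine h.congr_deriv ?_
    have hI := Complex.I_ne_zero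
    simp only [Pi.add_apply]
    field_simp
    linear_combination (E x * ω * (f' x)) * Complex.I_sq
  have hi1 : IntervalIntegrable (fun x => (f x : ℂ) * E x) volume a b :=
    Continuous.intervalIntegrable (by fun_prop) _ _
  have hi2 : IntervalIntegrable (fun x => (f'' x : ℂ) * E x / (ω : ℂ) ^ 2) volume a b :=
    Continuous.intervalIntegrable (by fun_prop) _ _
  have hftc := intervalIntegral.integral_eq_sub_of_hasDerivAt (fun x _ => hd x) (hi1.add hi2)
  rw [intervalIntegral.integral_add hi1 hi2, intervalIntegral.integral_div] at hftc
  have heq : ∫ x in a..b, (f x : ℂ) * E x =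
      (E b * f' b - E a * f' a - ∫ x in a..b, (f'' x : ℂ) * E x) / (ω : ℂ) ^ 2 := by
    rw [eq_sub_of_add_eq hftc, ha, hb]
    push_cast
    ring
  have hint : ‖∫ x in a..b, (f'' x : ℂ) * E x‖ ≤ ∫ x in a..b, |f'' x| := by
    refine (intervalIntegral.norm_integral_le_integral_norm hab).trans_eq ?_
    simp [hEn]
  rw [heq, norm_div, norm_pow, Complex.norm_real, Real.norm_eq_abs, sq_abs]
  gcongr
  calc _ ≤ ‖E b * f' b‖ + ‖E a * f' a‖ + ‖∫ x in a..b, (f'' x : ℂ) * E x‖ :=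
        (norm_sub_le _ _).trans (add_le_add_left (norm_sub_le _ _) _)
    _ ≤ _ := by
        simp only [norm_mul, hEn, Complex.norm_real, Real.norm_eq_abs, one_mul]
        linarith

/-- The dispersion relation `ω_h(n) = h²n³ - 1/(h²n)`. -/
def semiPhase (h : ℝ) (n : ℤ) : ℝ := h ^ 2 * (n : ℝ) ^ 3 - 1 / (h ^ 2 * n)

/-- Frequencies of equal sign satisfy a uniform gap condition. -/
lemma abs_sub_le_abs_semiPhase_sub {h : ℝ} (hh : 0 < h) {n m : ℤ} (hnm : 0 < n * m) :
    |((n - m : ℤ) : ℝ)| ≤ |semiPhase h n - semiPhase h m| := by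
  have hpos : (0 : ℝ) < n * m := by exact_mod_cast hnm
  have hn : (n : ℝ) ≠ 0 := left_ne_zero_of_mul hpos.ne'
  have hm : (m : ℝ) ≠ 0 := right_ne_zero_of_mul hpos.ne'
  have hx : 0 < h ^ 2 * (n * m) := by positivity
  have hfac : semiPhase h n - semiPhase h m =
      ((n - m : ℤ) : ℝ) * (h ^ 2 * (n ^ 2 + n * m + m ^ 2) + 1 / (h ^ 2 * (n * m))) := by
    unfold semiPhase
    push_cast
    field_simp
    ring
  have hge : 1 ≤ h ^ 2 * ((n : ℝ) ^ 2 + n * m + m ^ 2) + 1 / (h ^ 2 * (n * m)) := by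
    have h1 : h ^ 2 * ((n : ℝ) * m) ≤ h ^ 2 * ((n : ℝ) ^ 2 + n * m + m ^ 2) := by
      gcongr
      nlinarith [sq_nonneg (n : ℝ), sq_nonneg (m : ℝ)]
    have h2 : 1 ≤ h ^ 2 * ((n : ℝ) * m) + 1 / (h ^ 2 * (n * m)) := by
      generalize h ^ 2 * ((n : ℝ) * m) = x at hx
      rw [← sub_nonneg]
      have : x + 1 / x - 1 = ((x - 1) ^ 2 + x) / x := by field_simp; ring
      rw [this]
      positivity
    linarith
  rw [hfac, abs_mul]
  exact le_mul_of_one_le_right (abs_nonneg _) (hge.trans (le_abs_self _))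

lemma integral_parabola (T : ℝ) : ∫ t in (0:ℝ)..T, t * (T - t) = T ^ 3 / 6 := by
  simp only [mul_sub]
  rw [intervalIntegral.integral_sub (Continuous.intervalIntegrable (by fun_prop) _ _)
    (Continuous.intervalIntegrable (by fun_prop) _ _), intervalIntegral.integral_mul_const]
  simp only [← sq, integral_id, integral_pow]
  norm_num
  ring

/-- Fourier transform at `ω` of the parabolic window on `[0, T]`. -/
def windowTransform (T ω : ℝ) : ℂ :=
  ∫ t in (0:ℝ)..T, ((t * (T - t) : ℝ) : ℂ) * Complex.exp (Complex.I * ω * t)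

lemma windowTransform_zero (T : ℝ) : windowTransform T 0 = ((T ^ 3 / 6 : ℝ) : ℂ) := by
  rw [← integral_parabola, ← intervalIntegral.integral_ofReal]
  simp [windowTransform]

lemma norm_windowTransform_le {T : ℝ} (hT : 0 ≤ T) (ω : ℝ) :
    ‖windowTransform T ω‖ ≤ T ^ 3 / 6 := by
  rw [← integral_parabola]
  refine intervalIntegral.norm_integral_le_of_norm_le hT ?_
    (Continuous.intervalIntegrable (by fun_prop) _ _)
  refine .of_forall fun t ht => ?_
  rw [norm_mul, show Complex.I * ω * t = ((ω * t : ℝ) : ℂ) * Complex.I by push_cast; ring,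
    Complex.norm_exp_ofReal_mul_I, mul_one, Complex.norm_real, Real.norm_eq_abs,
    abs_of_nonneg (mul_nonneg ht.1.le (sub_nonneg.2 ht.2))]

lemma norm_windowTransform_le_div_sq {T : ℝ} (hT : 0 ≤ T) {ω : ℝ} (hω : ω ≠ 0) :
    ‖windowTransform T ω‖ ≤ 4 * T / ω ^ 2 := by
  have h1 : ∀ t : ℝ, HasDerivAt (fun t => t * (T - t)) (T - 2 * t) t := fun t =>
    ((hasDerivAt_id t).mul ((hasDerivAt_id t).const_sub T)).congr_deriv (by simp; ring)
  have h2 : ∀ t : ℝ, HasDerivAt (fun t => T - 2 * t) (-2) t := fun t =>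
    (((hasDerivAt_id t).const_mul 2).const_sub T).congr_deriv (by simp)
  have h := norm_integral_mul_exp_le hT h1 h2 continuous_const (by simp) (by simp) hω
  refine h.trans_eq ?_
  congr 1
  simp only [intervalIntegral.integral_const, smul_eq_mul, abs_neg]
  rw [show T - 2 * T = -T by ring, abs_neg, mul_zero, sub_zero, abs_of_nonneg hT, abs_two]
  ring

lemma fc_eq_fourierCoeff (u : Torus → ℂ) (k : ℤ) : fc u k = fourierCoeff u k := by
  rw [fc, fourierCoeff, AddCircle.integral_haarAddCircle]
  simp [Complex.real_smul]

/-- `L²(𝕋)` functions are `L²` for the normalized Haar measure. -/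
lemma memLp_haar (u : L2T) : MemLp (u : Torus → ℂ) 2 (@AddCircle.haarAddCircle (2 * Real.pi) _) :=
  MeasureTheory.memLp_haarAddCircle_iff.2 (Lp.memLp u)

lemma ae_volume_of_ae_haar {P : Torus → Prop}
    (h : ∀ᵐ x ∂(@AddCircle.haarAddCircle (2 * Real.pi) _), P x) :
    ∀ᵐ x ∂(volume : Measure Torus), P x := by
  rw [AddCircle.volume_eq_smul_haarAddCircle]
  exact Measure.ae_smul_measure h _

/-- A function with finitely many nonzero Fourier coefficients is a trigonometric polynomial. -/
lemma ae_eq_sum_fourier (u : L2T) (F : Finset ℤ) (hF : ∀ k ∉ F, fc u k = 0) :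
    (u : Torus → ℂ) =ᵐ[volume] fun x => ∑ n ∈ F, fc u n * fourier n x := by
  set v := (memLp_haar u).toLp
  have hvu : (v : Torus → ℂ) =ᵐ[AddCircle.haarAddCircle] u := (memLp_haar u).coeFn_toLp
  have hc : ∀ n, fourierCoeff v n = fc u n := fun n => by
    rw [fc_eq_fourierCoeff, fourierCoeff_congr_ae hvu]
  have h1 := hasSum_fourier_series_L2 v
  have h2 : v = ∑ n ∈ F, fourierCoeff v n • fourierLp 2 n :=
    h1.unique (hasSum_sum_of_ne_finset_zero fun n hn => by rw [hc, hF n hn, zero_smul])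
  have h3 : (v : Torus → ℂ) =ᵐ[AddCircle.haarAddCircle]
      fun x => ∑ n ∈ F, fc u n * fourier n x := by
    rw [h2]
    refine (Lp.coeFn_finsetSum _ _).trans ?_
    have : ∀ n : ℤ, ((fourierCoeff v n • fourierLp 2 n : Lp ℂ 2 AddCircle.haarAddCircle) :
        Torus → ℂ) =ᵐ[AddCircle.haarAddCircle] fun x => fc u n * fourier n x := fun n => by
      filter_upwards [Lp.coeFn_smul (fourierCoeff v n)
        (fourierLp 2 n : Lp ℂ 2 (@AddCircle.haarAddCircle (2 * Real.pi) _)),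
        coeFn_fourierLp (T := 2 * Real.pi) 2 n] with x hx hx'
      rw [hx, Pi.smul_apply, hx', hc, smul_eq_mul]
    filter_upwards [ae_all_iff.2 this] with x hx
    simp only [Finset.sum_apply, hx]
  exact ae_volume_of_ae_haar (hvu.symm.trans h3)

/-- Parseval's identity for trigonometric polynomials. -/
lemma norm_sq_eq_sum_fc (u : L2T) (F : Finset ℤ) (hF : ∀ k ∉ F, fc u k = 0) :
    ‖u‖ ^ 2 = 2 * Real.pi * ∑ n ∈ F, ‖fc u n‖ ^ 2 := by
  set v := (memLp_haar u).toLp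
  have hvu : (v : Torus → ℂ) =ᵐ[AddCircle.haarAddCircle] u := (memLp_haar u).coeFn_toLp
  have hc : ∀ n, fourierCoeff v n = fc u n := fun n => by
    rw [fc_eq_fourierCoeff, fourierCoeff_congr_ae hvu]
  have h1 : ∫ x, ‖v x‖ ^ 2 ∂AddCircle.haarAddCircle = ∑ n ∈ F, ‖fc u n‖ ^ 2 := by
    refine (hasSum_sq_fourierCoeff v).unique ?_
    simp only [hc]
    exact hasSum_sum_of_ne_finset_zero fun n hn => by rw [hF n hn]; simp
  have h2 : ∫ x, ‖v x‖ ^ 2 ∂AddCircle.haarAddCircle =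
      ∫ x, ‖u x‖ ^ 2 ∂(@AddCircle.haarAddCircle (2 * Real.pi) _) :=
    integral_congr_ae (hvu.mono fun x hx => by simp only [hx])
  have h3 : ‖u‖ ^ 2 = ∫ x, ‖u x‖ ^ 2 := by
    have h := congrArg RCLike.re (inner_self_eq_norm_sq_to_K (𝕜 := ℂ) u)
    rw [L2.inner_def, ← integral_re (L2.integrable_inner u u)] at h
    simp only [inner_self_eq_norm_sq_to_K] at h
    norm_cast at h
    simpa [← Complex.ofReal_pow] using h.symm
  rw [← h1, h2, h3, AddCircle.integral_haarAddCircle, smul_eq_mul, mul_inv_cancel_left₀]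
  positivity

/-- The unnormalized Fourier transform of `G²`. -/
def sqHat (G : Torus → ℝ) (j : ℤ) : ℂ := ∫ x : Torus, ((G x ^ 2 : ℝ) : ℂ) * fourier j x

lemma gMulNormSq_eq_re_sum {G : Torus → ℝ} (hG : Continuous G) (u : L2T) (F : Finset ℤ)
    (hF : ∀ k ∉ F, fc u k = 0) :
    gMulNormSq G u =
      (∑ n ∈ F, ∑ m ∈ F, fc u n * conj (fc u m) * sqHat G (n - m)).re := by
  have hcongr : gMulNormSq G u =
      ∫ x : Torus, ‖(G x : ℂ) * ∑ n ∈ F, fc u n * fourier n x‖ ^ 2 :=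
    integral_congr_ae ((ae_eq_sum_fourier u F hF).mono fun x hx => by simp only [hx])
  have hpt : ∀ x : Torus, ((‖(G x : ℂ) * ∑ n ∈ F, fc u n * fourier n x‖ ^ 2 : ℝ) : ℂ) =
      ∑ n ∈ F, ∑ m ∈ F, fc u n * conj (fc u m) * (((G x ^ 2 : ℝ) : ℂ) * fourier (n - m) x) := by
    intro x
    rw [Complex.ofReal_pow, ← Complex.mul_conj', map_mul, Complex.conj_ofReal, map_sum,
      mul_mul_mul_comm, Finset.sum_mul_sum, Finset.mul_sum]
    refine Finset.sum_congr rfl fun n _ => ?_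
    rw [Finset.mul_sum]
    refine Finset.sum_congr rfl fun m _ => ?_
    rw [sub_eq_add_neg, fourier_add, fourier_neg, map_mul]
    push_cast
    ring
  have hi : ∀ n m : ℤ, Integrable (fun x : Torus =>
      fc u n * conj (fc u m) * (((G x ^ 2 : ℝ) : ℂ) * fourier (n - m) x)) := fun n m =>
    Continuous.integrable_of_hasCompactSupport (by fun_prop) (HasCompactSupport.of_compactSpace _)
  rw [← Complex.ofReal_re (gMulNormSq G u), hcongr, ← integral_complex_ofReal]
  simp only [hpt]
  rw [integral_finsetSum _ fun n _ => integrable_finsetSum _ fun m _ => hi n m]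
  simp only [integral_finsetSum _ fun m _ => hi _ m, integral_const_mul, sqHat]

lemma sqHat_zero (G : Torus → ℝ) : sqHat G 0 = ((∫ x, G x ^ 2 : ℝ) : ℂ) := by
  rw [← integral_complex_ofReal]
  simp [sqHat]

lemma norm_fourier_apply (j : ℤ) (x : Torus) : ‖fourier j x‖ = 1 := by
  rw [fourier_apply, Circle.norm_coe]

lemma norm_sqHat_le (G : Torus → ℝ) (j : ℤ) : ‖sqHat G j‖ ≤ ∫ x, G x ^ 2 := by
  refine (norm_integral_le_integral_norm _).trans_eq ?_
  simp only [norm_mul, norm_fourier_apply, mul_one, Complex.norm_real, Real.norm_eq_abs, abs_sq]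

/-- Time evolution of the localized observation along a trigonometric polynomial, integrated
against the parabolic window. -/
lemma window_le_integral {G : Torus → ℝ} (hG : Continuous G) (F : Finset ℤ) (c : ℤ → ℂ)
    (ω : ℤ → ℝ) (u : ℝ → L2T) (hF : ∀ t, ∀ k ∉ F, fc (u t) k = 0)
    (hu : ∀ t, ∀ k ∈ F, fc (u t) k = Complex.exp (Complex.I * ω k * t) * c k)
    {T : ℝ} (hT : 0 ≤ T) :
    (∑ n ∈ F, ∑ m ∈ F, c n * conj (c m) *
        (windowTransform T (ω n - ω m) * sqHat G (n - m))).re ≤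
      T ^ 2 / 4 * ∫ t in (0:ℝ)..T, gMulNormSq G (u t) := by
  set q : ℝ → ℂ := fun t => ∑ n ∈ F, ∑ m ∈ F, c n * conj (c m) *
    (Complex.exp (Complex.I * (ω n - ω m : ℝ) * t) * sqHat G (n - m)) with hq
  have hqc : Continuous q := by fun_prop
  have hQ : ∀ t, gMulNormSq G (u t) = (q t).re := fun t => by
    rw [gMulNormSq_eq_re_sum hG (u t) F (hF t)]
    congr 1
    refine Finset.sum_congr rfl fun n hn => Finset.sum_congr rfl fun m hm => ?_
    rw [hu t n hn, hu t m hm, map_mul, ← Complex.exp_conj]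
    have : Complex.exp (Complex.I * (ω n - ω m : ℝ) * t) =
        Complex.exp (Complex.I * ω n * t) *
          Complex.exp (conj (Complex.I * ω m * t)) := by
      rw [← Complex.exp_add]
      simp only [map_mul, Complex.conj_I, Complex.conj_ofReal]
      push_cast
      ring_nf
    rw [this]
    ring
  have hQ0 : ∀ t, 0 ≤ (q t).re := fun t => by
    rw [← hQ]
    exact integral_nonneg fun x => sq_nonneg _
  have hwin : ∑ n ∈ F, ∑ m ∈ F, c n * conj (c m) *
      (windowTransform T (ω n - ω m) * sqHat G (n - m)) =
      ∫ t in (0:ℝ)..T, ((t * (T - t) : ℝ) : ℂ) * q t := by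
    have hpt : ∀ t : ℝ, ((t * (T - t) : ℝ) : ℂ) * q t = ∑ n ∈ F, ∑ m ∈ F,
        (c n * conj (c m) * sqHat G (n - m)) *
          (((t * (T - t) : ℝ) : ℂ) * Complex.exp (Complex.I * (ω n - ω m : ℝ) * t)) := fun t => by
      simp only [hq, Finset.mul_sum]
      refine Finset.sum_congr rfl fun n _ => Finset.sum_congr rfl fun m _ => ?_
      ring
    simp only [hpt]
    rw [intervalIntegral.integral_finsetSum fun n _ =>
      Continuous.intervalIntegrable (by fun_prop) _ _]
    refine Finset.sum_congr rfl fun n _ => ?_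
    rw [intervalIntegral.integral_finsetSum fun m _ =>
      Continuous.intervalIntegrable (by fun_prop) _ _]
    refine Finset.sum_congr rfl fun m _ => ?_
    rw [intervalIntegral.integral_const_mul, windowTransform]
    ring
  have hre : (∫ t in (0:ℝ)..T, ((t * (T - t) : ℝ) : ℂ) * q t).re =
      ∫ t in (0:ℝ)..T, t * (T - t) * (q t).re := by
    have h := Complex.reCLM.intervalIntegral_comp_comm (μ := volume) (a := 0) (b := T)
      (f := fun t : ℝ => ((t * (T - t) : ℝ) : ℂ) * q t)
      (Continuous.intervalIntegrable (by fun_prop) _ _)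
    rw [Complex.reCLM_apply] at h
    rw [← h]
    simp only [Complex.reCLM_apply, Complex.re_ofReal_mul]
  have hqr : Continuous fun t => (q t).re := Complex.continuous_re.comp hqc
  rw [hwin, hre]
  simp only [hQ]
  rw [← intervalIntegral.integral_const_mul]
  refine intervalIntegral.integral_mono_on hT (Continuous.intervalIntegrable (by fun_prop) _ _)
    (Continuous.intervalIntegrable (by fun_prop) _ _) fun t _ => ?_
  refine mul_le_mul_of_nonneg_right ?_ (hQ0 t)
  nlinarith [sq_nonneg (T - 2 * t)]

lemma integral_torus_eq {E : Type*} [NormedAddCommGroup E] [NormedSpace ℝ E] (f : Torus → E) :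
    ∫ x : Torus, f x = ∫ x in (-Real.pi)..Real.pi, f (x : Torus) := by
  rw [← AddCircle.intervalIntegral_preimage (2 * Real.pi) (-Real.pi)]
  congr 1
  ring

lemma fourier_torus_coe (j : ℤ) (x : ℝ) :
    fourier j (x : Torus) = Complex.exp (Complex.I * (j : ℝ) * x) := by
  rw [fourier_coe_apply]
  congr 1
  have : (Real.pi : ℂ) ≠ 0 := by exact_mod_cast Real.pi_ne_zero
  push_cast
  field_simp

/-- Quadratic decay of the Fourier transform of `g²` when `g` is `C²` and vanishes at `±π`. -/
lemma exists_norm_sqHat_le_div_sq {g : ℝ → ℝ} (hg : ContDiff ℝ 2 g)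
    (hper : Function.Periodic g (2 * Real.pi)) (hpi : g Real.pi = 0) (hnpi : g (-Real.pi) = 0) :
    ∃ D : ℝ, 0 ≤ D ∧ ∀ j : ℤ, j ≠ 0 → ‖sqHat hper.lift j‖ ≤ D / (j : ℝ) ^ 2 := by
  have hg1 : ContDiff ℝ 1 (deriv g) := ((contDiff_succ_iff_deriv (n := 1)).1 hg).2.2
  have hd1 : ∀ x, HasDerivAt g (deriv g x) x := fun x =>
    (hg.differentiable (by norm_num) x).hasDerivAt
  have hd2 : ∀ x, HasDerivAt (deriv g) (deriv (deriv g) x) x := fun x =>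
    (hg1.differentiable (by norm_num) x).hasDerivAt
  have hc2 : Continuous (deriv (deriv g)) := hg1.continuous_deriv le_rfl
  have hc0 := hg.continuous
  have hc1 := hg1.continuous
  have h1 : ∀ x, HasDerivAt (fun x => g x ^ 2) (2 * (g x * deriv g x)) x := fun x =>
    ((hd1 x).pow 2).congr_deriv (by simp; ring)
  have h2 : ∀ x, HasDerivAt (fun x => 2 * (g x * deriv g x))
      (2 * (deriv g x * deriv g x + g x * deriv (deriv g) x)) x := fun x =>
    ((hd1 x).mul (hd2 x)).const_mul 2
  have hle : -Real.pi ≤ Real.pi := by linarith [Real.pi_pos]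
  refine ⟨∫ x in (-Real.pi)..Real.pi, |2 * (deriv g x * deriv g x + g x * deriv (deriv g) x)|,
    intervalIntegral.integral_nonneg hle fun _ _ => abs_nonneg _, fun j hj => ?_⟩
  have h := norm_integral_mul_exp_le hle h1 h2 (by fun_prop) (by simp [hnpi]) (by simp [hpi])
    (ω := (j : ℝ)) (by exact_mod_cast hj)
  simp only [hpi, hnpi, zero_mul, mul_zero, abs_zero, zero_add] at h
  rw [sqHat, integral_torus_eq]
  simpa only [Function.Periodic.lift_coe, fourier_torus_coe] using h

lemma integral_sq_pos {g : ℝ → ℝ} (hg : Continuous g)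
    (hint : ∫ x in (-Real.pi)..Real.pi, g x = 1) :
    0 < ∫ x in (-Real.pi)..Real.pi, g x ^ 2 := by
  have hpi := Real.pi_pos
  have h0 : 0 ≤ ∫ x in (-Real.pi)..Real.pi, (g x - 1 / (2 * Real.pi)) ^ 2 :=
    intervalIntegral.integral_nonneg (by linarith) fun _ _ => sq_nonneg _
  have hI : ∀ f : ℝ → ℝ, Continuous f → IntervalIntegrable f volume (-Real.pi) Real.pi :=
    fun f hf => hf.intervalIntegrable _ _
  have h1 : ∫ x in (-Real.pi)..Real.pi, (g x - 1 / (2 * Real.pi)) ^ 2 =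
      (∫ x in (-Real.pi)..Real.pi, g x ^ 2) - 1 / (2 * Real.pi) := by
    have : ∀ x, (g x - 1 / (2 * Real.pi)) ^ 2 =
        g x ^ 2 - (1 / Real.pi) * g x + (1 / (2 * Real.pi)) ^ 2 := fun x => by
      field_simp
      ring
    simp only [this]
    rw [intervalIntegral.integral_add (hI _ (by fun_prop)) (hI _ (by fun_prop)),
      intervalIntegral.integral_sub (hI _ (by fun_prop)) (hI _ (by fun_prop)),
      intervalIntegral.integral_const_mul, hint, intervalIntegral.integral_const, smul_eq_mul]
    field_simp
    ring
  have h2 : 0 < 1 / (2 * Real.pi) := by positivity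
  linarith

lemma one_div_sq_le_rpow {x : ℝ} (hx : 1 ≤ x) : 1 / x ^ 2 ≤ x ^ (-(3 / 2 : ℝ)) := by
  have h : 1 / x ^ 2 = x ^ (-2 : ℝ) := by
    rw [Real.rpow_neg (by linarith), one_div]
    norm_cast
  rw [h]
  exact Real.rpow_le_rpow_of_exponent_le hx (by norm_num)

lemma one_div_sq_le_mul_rpow {x δ : ℝ} (hδ : 0 < δ) (hx : 0 < x) (h : 1 ≤ δ ^ 2 * x) :
    1 / x ^ 2 ≤ δ * x ^ (-(3 / 2 : ℝ)) := by
  have h1 : 1 / x ^ 2 = x ^ (-(1 / 2) : ℝ) * x ^ (-(3 / 2) : ℝ) := by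
    rw [← Real.rpow_add hx, one_div, ← Real.rpow_natCast, ← Real.rpow_neg hx.le]
    norm_num
  rw [h1]
  refine mul_le_mul_of_nonneg_right ?_ (by positivity)
  rw [Real.rpow_neg hx.le, ← Real.sqrt_eq_rpow]
  refine inv_le_of_inv_le₀ hδ (Real.le_sqrt_of_sq_le ?_)
  rw [inv_pow]
  exact (inv_le_iff_one_le_mul₀' (by positivity)).2 h

/-- Observability for trigonometric flows whose resonances occur only between far-apart
frequencies. -/
lemma re_sum_window_ge {G : Torus → ℝ} {d D δ T : ℝ} (F : Finset ℤ) (c : ℤ → ℂ) (ω : ℤ → ℝ)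
    (hd : ∫ x, G x ^ 2 = d) (hd0 : 0 < d) (hD : 0 ≤ D)
    (hdecay : ∀ j : ℤ, j ≠ 0 → ‖sqHat G j‖ ≤ D / (j : ℝ) ^ 2) (hδ : 0 < δ) (hT : 1 ≤ T)
    (hTS : 96 * ∑' j : ℤ, |(j : ℝ)| ^ (-(3 / 2 : ℝ)) ≤ T)
    (hδS : 4 * D * δ * ∑' j : ℤ, |(j : ℝ)| ^ (-(3 / 2 : ℝ)) ≤ d)
    (hω : ∀ n ∈ F, ∀ m ∈ F, n ≠ m →
      |((n - m : ℤ) : ℝ)| ≤ |ω n - ω m| ∨ 1 ≤ δ ^ 2 * |((n - m : ℤ) : ℝ)|) :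
    T ^ 3 * d / 12 * ∑ n ∈ F, ‖c n‖ ^ 2 ≤
      (∑ n ∈ F, ∑ m ∈ F, c n * conj (c m) *
        (windowTransform T (ω n - ω m) * sqHat G (n - m))).re := by
  have hs : Summable fun j : ℤ => |(j : ℝ)| ^ (-(3 / 2 : ℝ)) :=
    Real.summable_abs_int_rpow (by norm_num)
  have hT0 : 0 < T := by linarith
  have hoff : ∀ n ∈ F, ∀ m ∈ F, n ≠ m →
      ‖windowTransform T (ω n - ω m) * sqHat G (n - m)‖ ≤
        (4 * T * d + T ^ 3 / 6 * D * δ) * |((n - m : ℤ) : ℝ)| ^ (-(3 / 2 : ℝ)) := by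
    intro n hn m hm hnm
    have hj : n - m ≠ 0 := sub_ne_zero.2 hnm
    have hx : (1 : ℝ) ≤ |((n - m : ℤ) : ℝ)| := by
      exact_mod_cast Int.one_le_abs hj
    have hjd := hdecay (n - m) hj
    have hjn : ‖sqHat G (n - m)‖ ≤ d := hd ▸ norm_sqHat_le G (n - m)
    rw [← sq_abs] at hjd
    have hres := hω n hn m hm hnm
    generalize |((n - m : ℤ) : ℝ)| = x at hx hjd hres ⊢
    have hx0 : 0 < x := by linarith
    rw [norm_mul, add_mul]
    rcases hres with h | h
    · have hw0 : ω n - ω m ≠ 0 := abs_pos.1 (hx0.trans_le h)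
      have hw : ‖windowTransform T (ω n - ω m)‖ ≤ 4 * T * x ^ (-(3 / 2 : ℝ)) := by
        refine (norm_windowTransform_le_div_sq hT0.le hw0).trans ?_
        rw [← sq_abs, div_eq_mul_one_div]
        refine mul_le_mul_of_nonneg_left (le_trans ?_ (one_div_sq_le_rpow hx)) (by positivity)
        gcongr
      calc _ ≤ 4 * T * x ^ (-(3 / 2 : ℝ)) * d := by gcongr
        _ = 4 * T * d * x ^ (-(3 / 2 : ℝ)) := by ring
        _ ≤ _ := le_add_of_nonneg_right (by positivity)
    · calc _ ≤ T ^ 3 / 6 * (D / x ^ 2) := by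
            gcongr
            exact norm_windowTransform_le hT0.le _
        _ = T ^ 3 / 6 * D * (1 / x ^ 2) := by ring
        _ ≤ T ^ 3 / 6 * D * (δ * x ^ (-(3 / 2 : ℝ))) := by
            gcongr
            exact one_div_sq_le_mul_rpow hδ hx0 h
        _ = T ^ 3 / 6 * D * δ * x ^ (-(3 / 2 : ℝ)) := by ring
        _ ≤ _ := le_add_of_nonneg_left (by positivity)
  have h := le_re_sum_of_offDiag_le F c
    (fun n m => windowTransform T (ω n - ω m) * sqHat G (n - m))
    (p := fun j : ℤ => |(j : ℝ)| ^ (-(3 / 2 : ℝ))) (fun j => by positivity)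
    (fun j => by simp) hs (d := T ^ 3 / 6 * d) (η := 4 * T * d + T ^ 3 / 6 * D * δ)
    (by positivity)
    (fun n _ => by rw [sub_self, sub_self, windowTransform_zero, sqHat_zero, hd]; push_cast; rfl)
    hoff
  refine le_trans (mul_le_mul_of_nonneg_right ?_ (by positivity)) h
  set σ := ∑' j : ℤ, |(j : ℝ)| ^ (-(3 / 2 : ℝ))
  have e1 : 4 * T * d * σ ≤ T ^ 3 * d / 24 := by
    have : 96 * σ ≤ T ^ 2 := hTS.trans (by nlinarith)
    have := mul_le_mul_of_nonneg_left this (show 0 ≤ T * d / 24 by positivity)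
    linarith
  have e2 : T ^ 3 / 6 * D * δ * σ ≤ T ^ 3 * d / 24 := by
    have := mul_le_mul_of_nonneg_left hδS (show 0 ≤ T ^ 3 / 24 by positivity)
    linarith
  linarith

/-- Proposition 3.8, frequency-localized semiclassical observability:
there are `ε₀, h₀ ∈ (0,1)`, `T₀ > 0` and `C₀ > 0` such that for all `k ∈ ℤ` and `h ∈ (0,h₀)`
with `2ᵏh ≤ ε₀`,
`‖ψ_k(hDₓ)u₀‖²_{L²} ≤ C₀ ∫₀^{T₀} ‖g·ψ_k(hDₓ)(Sʰ(t)u₀)‖²_{L²} dt` for all `u₀ ∈ L²₀(𝕋)`. -/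
theorem frequency_localized_semiclassical_observability
    -- `g` is a fixed real-valued C² function on `𝕋` (2π-periodic on `ℝ`), nonnegative,
    -- with integral 1, vanishing outside `(a,b) ⊂ (-π,π)`:
    (g : ℝ → ℝ) (hg_reg : ContDiff ℝ 2 g) (hg_per : Function.Periodic g (2 * Real.pi))
    (hg_nonneg : ∀ x, 0 ≤ g x)
    (a b : ℝ) (ha : -Real.pi < a) (hab : a < b) (hb : b < Real.pi)
    (hg_supp : ∀ x ∈ Set.Ioc (-Real.pi) Real.pi, g x ≠ 0 → x ∈ Set.Ioo a b)
    (hg_int : ∫ x in (-Real.pi)..Real.pi, g x = 1)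
    (ψ : ℝ → ℝ) (hψ_reg : ContDiff ℝ (⊤ : ℕ∞) ψ) (hψ_cpt : HasCompactSupport ψ)
    (hψ_supp : ∀ ξ : ℝ, ψ ξ ≠ 0 → 1/2 ≤ |ξ| ∧ |ξ| ≤ 2) :
    ∃ ε₀ ∈ Set.Ioo (0:ℝ) 1, ∃ h₀ ∈ Set.Ioo (0:ℝ) 1, ∃ T₀ : ℝ, 0 < T₀ ∧ ∃ C₀ : ℝ, 0 < C₀ ∧
      ∀ k : ℤ, ∀ h : ℝ, 0 < h → h < h₀ → (2:ℝ) ^ k * h ≤ ε₀ →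
        ∀ M : L2T →L[ℂ] L2T, IsMult (fun ξ => ψ ((2:ℝ) ^ k * ξ)) h M →
          ∀ S : ℝ → L2T →L[ℂ] L2T, IsSemiGroup h S →
            ∀ u₀ : L2T, MeanZero u₀ →
              ‖M u₀‖ ^ 2 ≤ C₀ * ∫ t in (0:ℝ)..T₀, gMulNormSq hg_per.lift (M (S t u₀)) := by
  have hpi := Real.pi_pos
  have hg_pi : g Real.pi = 0 := by
    by_contra h
    exact absurd (hg_supp Real.pi ⟨by linarith, le_rfl⟩ h).2 (by linarith)
  have hg_npi : g (-Real.pi) = 0 := by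
    rw [← hg_pi, ← hg_per (-Real.pi)]
    congr 1
    ring
  have hG : Continuous hg_per.lift := continuous_coinduced_dom.2 hg_reg.continuous
  obtain ⟨D, hD, hdecay⟩ := exists_norm_sqHat_le_div_sq hg_reg hg_per hg_pi hg_npi
  set d := ∫ x in (-Real.pi)..Real.pi, g x ^ 2 with hd_def
  have hd0 : 0 < d := integral_sq_pos hg_reg.continuous hg_int
  have hd : ∫ x, hg_per.lift x ^ 2 = d := by
    rw [integral_torus_eq]
    simp only [Function.Periodic.lift_coe, hd_def]
  set σ := ∑' j : ℤ, |(j : ℝ)| ^ (-(3 / 2 : ℝ))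
  have hσ0 : 0 ≤ σ := tsum_nonneg fun j => by positivity
  set δ := min (1 / 2) (d / (4 * D * σ + 1))
  have hδ0 : 0 < δ := by positivity
  have hδS : 4 * D * δ * σ ≤ d := by
    have h1 : δ * (4 * D * σ + 1) ≤ d := (le_div_iff₀ (by positivity)).1 (min_le_right _ _)
    linarith
  have hδ1 : δ ≤ 1 / 2 := min_le_left _ _
  set T := 1 + 96 * σ
  have hT : 1 ≤ T := by linarith
  have hT0 : 0 < T := by linarith
  refine ⟨δ ^ 2, ⟨by positivity, by nlinarith⟩, 1 / 2, by norm_num, T, hT0,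
    6 * Real.pi / (T * d), by positivity, ?_⟩
  intro k h hh _ hkh M hM S hS u₀ hu₀
  have ha0 : 0 < (2 : ℝ) ^ k := by positivity
  set F : Finset ℤ := (Finset.Icc (-⌈2 / ((2 : ℝ) ^ k * h)⌉) ⌈2 / ((2 : ℝ) ^ k * h)⌉).filter
    fun n => ψ ((2 : ℝ) ^ k * (h * n)) ≠ 0
  have hsupp : ∀ n : ℤ, ψ ((2 : ℝ) ^ k * (h * n)) ≠ 0 →
      1 / 2 ≤ (2 : ℝ) ^ k * h * |(n : ℝ)| ∧ (2 : ℝ) ^ k * h * |(n : ℝ)| ≤ 2 := fun n hn => by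
    have := hψ_supp _ hn
    rwa [← mul_assoc, abs_mul, abs_of_pos (mul_pos ha0 hh)] at this
  have hnF : ∀ n ∉ F, ψ ((2 : ℝ) ^ k * (h * n)) = 0 := fun n hn => by
    by_contra hne
    refine hn (Finset.mem_filter.2 ⟨?_, hne⟩)
    have h1 : |(n : ℝ)| ≤ 2 / ((2 : ℝ) ^ k * h) := by
      rw [le_div_iff₀ (mul_pos ha0 hh), mul_comm]
      exact (hsupp n hne).2
    have h2 : |(n : ℝ)| ≤ ⌈2 / ((2 : ℝ) ^ k * h)⌉ := h1.trans (Int.le_ceil _)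
    have h3 : |n| ≤ ⌈2 / ((2 : ℝ) ^ k * h)⌉ := by exact_mod_cast h2
    exact Finset.mem_Icc.2 (abs_le.1 h3)
  have hF0 : ∀ n ∈ F, n ≠ 0 := fun n hn h0 => by
    have := (hsupp n (Finset.mem_filter.1 hn).2).1
    rw [h0] at this
    norm_num at this
  have hvan : ∀ u : L2T, ∀ n ∉ F, fc (M u) n = 0 := fun u n hn => by
    rw [hM]
    simp only [hnF n hn, Complex.ofReal_zero, zero_mul]
  have hev : ∀ t : ℝ, ∀ n ∈ F, fc (M (S t u₀)) n =
      Complex.exp (Complex.I * semiPhase h n * t) * fc (M u₀) n := fun t n hn => by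
    rw [hM, hM, (hS t u₀ hu₀).2 n (hF0 n hn), semiPhase]
    push_cast
    rw [mul_left_comm]
    congr 2
    ring
  have hω : ∀ n ∈ F, ∀ m ∈ F, n ≠ m →
      |((n - m : ℤ) : ℝ)| ≤ |semiPhase h n - semiPhase h m| ∨
        1 ≤ δ ^ 2 * |((n - m : ℤ) : ℝ)| := by
    intro n hn m hm _
    rcases (mul_ne_zero (hF0 n hn) (hF0 m hm)).lt_or_gt with hneg | hpos
    · right
      have hneg' : (n : ℝ) * m < 0 := by exact_mod_cast hneg
      have habs : |((n - m : ℤ) : ℝ)| = |(n : ℝ)| + |(m : ℝ)| := by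
        push_cast
        rcases mul_neg_iff.1 hneg' with ⟨h1, h2⟩ | ⟨h1, h2⟩
        · rw [abs_of_pos h1, abs_of_neg h2, abs_of_pos (by linarith)]
          ring
        · rw [abs_of_neg h1, abs_of_pos h2, abs_of_neg (by linarith)]
          ring
      have h1 := (hsupp n (Finset.mem_filter.1 hn).2).1
      have h2 := (hsupp m (Finset.mem_filter.1 hm).2).1
      calc 1 ≤ (2 : ℝ) ^ k * h * |((n - m : ℤ) : ℝ)| := by rw [habs]; linarith
        _ ≤ _ := by gcongr
    · exact Or.inl (abs_sub_le_abs_semiPhase_sub hh hpos)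
  have hlow := re_sum_window_ge F (fun n => fc (M u₀) n) (semiPhase h) hd hd0 hD hdecay hδ0 hT
    (by linarith) hδS hω
  have hup := window_le_integral hG F (fun n => fc (M u₀) n) (semiPhase h)
    (fun t => M (S t u₀)) (fun t => hvan (S t u₀)) hev hT0.le
  have hmain := hlow.trans hup
  rw [norm_sq_eq_sum_fc (M u₀) F (hvan u₀), div_mul_eq_mul_div, le_div_iff₀ (by positivity)]
  have hscale := mul_le_mul_of_nonneg_left hmain (show 0 ≤ 24 * Real.pi / T ^ 2 by positivity)
  convert hscale using 1 <;> field_simp <;> ring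
end
end
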